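/- Every graph G either contains k pairwise edge-disjoint cycles of length at least ℓ, or there is an edge set X with |X| ≤ 210·k²·log₂ k + 10·ℓ·(k−1) such that G − X contains no cycle of length at least ℓ. -/

import Mathlib

open SimpleGraph


set_option linter.unusedSectionVars false
set_option linter.unusedVariables false

namespace LC
open Finset
open scoped symmDiff

section basics
variable {E V : Type*} [DecidableEq E] [DecidableEq V]

/-- mod-2 unit vector -/
def dl (a : V) : V → ZMod 2 := fun v => if a = v then 1 else 0

/-- mod-2 incidence vector of an edge with ends `s e`, `t e`. -/
def inc (s t : E → V) (e : E) : V → ZMod 2 := dl (s e) + dl (t e)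

/-- mod-2 boundary of an edge set -/
def bd (s t : E → V) (F : Finset E) : V → ZMod 2 := ∑ e ∈ F, inc s t e

/-- even edge sets -/
def Ev (s t : E → V) (F : Finset E) : Prop := bd s t F = 0

/-- circuits: minimal nonempty even sets -/
def Circ (s t : E → V) (C : Finset E) : Prop :=
  C.Nonempty ∧ Ev s t C ∧ ∀ F ⊆ C, F.Nonempty → Ev s t F → F = C

theorem two_zero (x : ZMod 2) : x + x = 0 := CharTwo.add_self_eq_zero x

theorem two_zero' (x : V → ZMod 2) : x + x = 0 := by
  funext v; exact two_zero _

theorem sum_symmDiff {M : Type*} [AddCommGroup M] (h2 : ∀ x : M, x + x = 0)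
    (w : E → M) (A B : Finset E) :
    ∑ e ∈ A ∆ B, w e = ∑ e ∈ A, w e + ∑ e ∈ B, w e := by
  have hd : Disjoint (A \ B) (B \ A) := by
    rw [Finset.disjoint_left]; intro x hx hx'
    simp only [mem_sdiff] at hx hx'; exact hx.2 hx'.1
  have h1 : ∑ e ∈ A ∆ B, w e = ∑ e ∈ A \ B, w e + ∑ e ∈ B \ A, w e := by
    rw [← sum_union hd]; rfl
  have hA : ∑ e ∈ A, w e = ∑ e ∈ A \ B, w e + ∑ e ∈ A ∩ B, w e :=
    (add_comm _ _).trans (sum_inter_add_sum_sdiff A B w) |>.symm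
  have hB : ∑ e ∈ B, w e = ∑ e ∈ B \ A, w e + ∑ e ∈ A ∩ B, w e := by
    rw [inter_comm]; exact ((add_comm _ _).trans (sum_inter_add_sum_sdiff B A w)).symm
  rw [h1, hA, hB]
  have := h2 (∑ e ∈ A ∩ B, w e)
  calc _ = ∑ e ∈ A \ B, w e + ∑ e ∈ B \ A, w e + 0 := by rw [add_zero]
    _ = _ := by rw [← this]; abel

variable {s t : E → V}

theorem bd_symmDiff (A B : Finset E) : bd s t (A ∆ B) = bd s t A + bd s t B :=
  sum_symmDiff two_zero' _ A B

theorem bd_empty : bd s t ∅ = 0 := by simp [bd]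

theorem ev_empty : Ev s t ∅ := bd_empty

theorem Ev.symm {A B : Finset E} (hA : Ev s t A) (hB : Ev s t B) : Ev s t (A ∆ B) := by
  unfold Ev at *; rw [bd_symmDiff, hA, hB, add_zero]

theorem bd_apply (F : Finset E) (v : V) : bd s t F v = ∑ e ∈ F, inc s t e v := by
  simp [bd, Finset.sum_apply]

theorem Ev.sdiff {A B : Finset E} (hA : Ev s t A) (hB : Ev s t B) (h : B ⊆ A) :
    Ev s t (A \ B) := by
  have : A ∆ B = A \ B := by
    ext x; simp only [mem_symmDiff, mem_sdiff]; grind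
  rw [← this]; exact hA.symm hB

theorem Ev.exists_circ {F : Finset E} (hF : Ev s t F) {e : E} (he : e ∈ F) :
    ∃ C ⊆ F, Circ s t C ∧ e ∈ C := by
  induction F using Finset.strongInduction with
  | H F ih =>
    by_cases hc : Circ s t F
    · exact ⟨F, subset_rfl, hc, he⟩
    · have : ∃ F' ⊆ F, F'.Nonempty ∧ Ev s t F' ∧ F' ≠ F := by
        by_contra hcon
        push Not at hcon
        exact hc ⟨⟨e, he⟩, hF, fun F' h1 h2 h3 => hcon F' h1 h2 h3⟩
      obtain ⟨F', h1, h2, h3, h4⟩ := this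
      by_cases he' : e ∈ F'
      · obtain ⟨C, hC, h⟩ := ih F' (h1.ssubset_of_ne h4) h3 he'
        exact ⟨C, hC.trans h1, h⟩
      · have hss : F \ F' ⊂ F := by
          refine ⟨sdiff_subset, fun h => ?_⟩
          obtain ⟨x, hx⟩ := h2
          have := h (h1 hx)
          simp only [mem_sdiff] at this
          exact this.2 hx
        obtain ⟨C, hC, h⟩ := ih (F \ F') hss (hF.sdiff h3 h1) (by simp [he, he'])
        exact ⟨C, hC.trans sdiff_subset, h⟩

theorem Circ.eq_of_subset {C D : Finset E} (hC : Circ s t C) (hD : Circ s t D) (h : D ⊆ C) :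
    D = C := hC.2.2 D h hD.1 hD.2.1

/-- two intersecting circuits: a circuit through any two given elements -/
theorem circ_trans {C1 C2 : Finset E} (h1 : Circ s t C1) (h2 : Circ s t C2) {e g : E}
    (he : e ∈ C1) (hg : g ∈ C2) (hm : (C1 ∩ C2).Nonempty) :
    ∃ C ⊆ C1 ∪ C2, Circ s t C ∧ e ∈ C ∧ g ∈ C := by
  obtain ⟨n, hn⟩ : ∃ n, (C2 \ C1).card = n := ⟨_, rfl⟩
  induction n using Nat.strong_induction_on generalizing C2 with
  | _ n ih =>
    by_cases hgC : g ∈ C1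
    · exact ⟨C1, subset_union_left, h1, he, hgC⟩
    by_cases heC : e ∈ C2
    · exact ⟨C2, subset_union_right, h2, heC, hg⟩
    have hev : Ev s t (C1 ∆ C2) := h1.2.1.symm h2.2.1
    obtain ⟨A, hA, hAc, hgA⟩ := hev.exists_circ (e := g) (by simp [mem_symmDiff, hg, hgC])
    have hAu : A ⊆ C1 ∪ C2 := hA.trans symmDiff_subset_union
    obtain ⟨x, hx⟩ := hm
    rw [mem_inter] at hx
    have hxA : x ∉ A := fun h => by
      have := hA h; simp [mem_symmDiff, hx.1, hx.2] at this
    have hne : A ≠ C2 := fun h => hxA (h ▸ hx.2)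
    have hAm : (C1 ∩ A).Nonempty := by
      by_contra hcon
      rw [not_nonempty_iff_eq_empty] at hcon
      apply hne
      refine h2.eq_of_subset hAc fun y hy => ?_
      have h3 := hAu hy
      rw [mem_union] at h3
      rcases h3 with h3 | h3
      · exact absurd (mem_inter.2 ⟨h3, hy⟩) (by rw [hcon]; simp)
      · exact h3
    have hsub : A \ C1 ⊆ C2 \ C1 := fun y hy => by
      rw [mem_sdiff] at *
      have h3 := hAu hy.1
      rw [mem_union] at h3
      exact ⟨h3.resolve_left hy.2, hy.2⟩
    by_cases hlt : (A \ C1).card < n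
    · obtain ⟨C, hC, h⟩ := ih _ hlt hAc hgA hAm rfl
      exact ⟨C, hC.trans (union_subset subset_union_left hAu), h⟩
    · have heq : A \ C1 = C2 \ C1 := eq_of_subset_of_card_le hsub (by omega)
      have hAC : A ∆ C2 ⊆ C1 := fun y hy => by
        by_contra hy1
        have : y ∈ A \ C1 ↔ y ∈ C2 \ C1 := by rw [heq]
        simp only [mem_sdiff, hy1, not_false_eq_true, and_true] at this
        rw [mem_symmDiff] at hy
        tauto
      have h4 : A ∆ C2 = C1 := h1.2.2 _ hAC (by simpa using hne) (hAc.2.1.symm h2.2.1)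
      have h5 : e ∈ A ∆ C2 := h4 ▸ he
      rw [mem_symmDiff] at h5
      exact ⟨A, hAu, hAc, by tauto, hgA⟩

/-- all circuits inside `K` have fewer than `l` elements -/
def AllShort (s t : E → V) (l : ℕ) (K : Finset E) : Prop :=
  ∀ C ⊆ K, Circ s t C → C.card < l

/-- no circuit has size in `[l, 10 l]` -/
def Gap (s t : E → V) (l : ℕ) (K : Finset E) : Prop :=
  ∀ C ⊆ K, Circ s t C → C.card ≤ 10 * l → C.card < l

theorem Gap.mono {l : ℕ} {K K' : Finset E} (h : Gap s t l K) (hK : K' ⊆ K) : Gap s t l K' :=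
  fun C hC => h C (hC.trans hK)

/-- Sliding lemma. -/
theorem allShort_insert {l : ℕ} {K : Finset E} {e : E} (heK : e ∉ K)
    (hK : AllShort s t l K) (hgap : Gap s t l (insert e K))
    {D : Finset E} (hD : Circ s t D) (hDK : D ⊆ insert e K) (heD : e ∈ D) (hDl : D.card < l) :
    AllShort s t l (insert e K) := by
  intro C hC hCc
  obtain ⟨n, hn⟩ : ∃ n, (C \ D).card = n := ⟨_, rfl⟩
  induction n using Nat.strong_induction_on generalizing C with
  | _ n ih =>
    by_contra hlong
    push Not at hlong
    have hbig : 10 * l < C.card := by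
      by_contra h; have := hgap C hC hCc (by omega); omega
    have sub_of : ∀ A ⊆ insert e K, e ∉ A → A ⊆ K := fun A hA heA y hy => by
      rcases mem_insert.1 (hA hy) with h | h
      · exact absurd (h ▸ hy) heA
      · exact h
    have heC : e ∈ C := by
      by_contra h
      have := hK C (sub_of C hC h) hCc
      omega
    have hCD : C ≠ D := fun h => by rw [h] at hlong; omega
    -- choose D'
    have hex : ∃ m, ∃ D', Circ s t D' ∧ D' ⊆ C ∪ D ∧ e ∉ D' ∧ (D' \ C).card = m := by
      have hev := hCc.2.1.symm hD.2.1
      obtain ⟨x, hx⟩ : (C ∆ D).Nonempty := by simpa using hCD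
      obtain ⟨A, hA, hAc, _⟩ := hev.exists_circ hx
      refine ⟨_, A, hAc, hA.trans symmDiff_subset_union, fun h => ?_, rfl⟩
      have := hA h
      simp [mem_symmDiff, heC, heD] at this
    classical
    obtain ⟨D', hD'c, hD'u, heD', hD'm⟩ := Nat.find_spec hex
    have hmin : ∀ B, Circ s t B → B ⊆ C ∪ D → e ∉ B → (D' \ C).card ≤ (B \ C).card := by
      intro B h1 h2 h3
      rw [hD'm]
      exact Nat.find_min' hex ⟨B, h1, h2, h3, rfl⟩
    have hCDK : C ∪ D ⊆ insert e K := union_subset hC hDK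
    have hD's : D'.card < l := hK D' (sub_of _ (hD'u.trans hCDK) heD') hD'c
    obtain ⟨x, hxD', hxD⟩ : ∃ x ∈ D', x ∉ D := by
      by_contra h
      push Not at h
      exact heD' ((hD.eq_of_subset hD'c h) ▸ heD)
    have hxC : x ∈ C := (mem_union.1 (hD'u hxD')).resolve_right hxD
    have hev : Ev s t (C ∆ D') := hCc.2.1.symm hD'c.2.1
    have heCD' : e ∈ C ∆ D' := by simp [mem_symmDiff, heC, heD']
    obtain ⟨A, hA, hAc, heA⟩ := hev.exists_circ heCD'
    have hAeq : A = C ∆ D' := by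
      by_contra hne
      have hev2 := hev.sdiff hAc.2.1 hA
      obtain ⟨y, hy⟩ : (C ∆ D' \ A).Nonempty := by
        rw [sdiff_nonempty]; exact fun h => hne (hA.antisymm h)
      obtain ⟨B, hB, hBc, _⟩ := hev2.exists_circ hy
      have heB : e ∉ B := fun h => (mem_sdiff.1 (hB h)).2 heA
      have hB1 : B ⊆ C ∆ D' := hB.trans sdiff_subset
      have hB2 : B ⊆ C ∪ D := (hB1.trans symmDiff_subset_union).trans
        (union_subset subset_union_left hD'u)
      have hBs : B \ C ⊆ D' \ C := fun z hz => by
        have h1 := hB1 (mem_sdiff.1 hz).1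
        simp only [mem_symmDiff, mem_sdiff] at h1 hz ⊢
        tauto
      have hBeq : B \ C = D' \ C := eq_of_subset_of_card_le hBs (hmin B hBc hB2 heB)
      have hsub : B ∆ D' ⊆ C := fun z hz => by
        by_contra hz1
        have : z ∈ B \ C ↔ z ∈ D' \ C := by rw [hBeq]
        simp only [mem_sdiff, hz1, not_false_eq_true, and_true] at this
        rw [mem_symmDiff] at hz
        tauto
      have hBD' : B = D' := by
        by_contra hne
        have h1 := hCc.2.2 _ hsub (by simpa using hne) (hBc.2.1.symm hD'c.2.1)
        have : e ∈ B ∆ D' := h1 ▸ heC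
        rw [mem_symmDiff] at this
        tauto
      have h1 := hB1 (hBD' ▸ hxD')
      simp [mem_symmDiff, hxC, hxD'] at h1
    rw [hAeq] at hAc
    have hsubK : C ∆ D' ⊆ insert e K := symmDiff_subset_union.trans
      (union_subset hC (hD'u.trans hCDK))
    have hlt : ((C ∆ D') \ D).card < n := by
      rw [← hn]
      apply card_lt_card
      refine ⟨fun z hz => ?_, fun h => ?_⟩
      · simp only [mem_symmDiff, mem_sdiff] at hz ⊢
        rcases hz with ⟨h1 | h1, h2⟩
        · exact ⟨h1.1, h2⟩
        · have := hD'u h1.1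
          rw [mem_union] at this
          tauto
      · have := h (mem_sdiff.2 ⟨hxC, hxD⟩)
        simp [mem_symmDiff, hxC, hxD'] at this
    have := ih _ hlt (C ∆ D') hsubK hAc rfl
    have hle : C.card ≤ (C ∆ D').card + D'.card := by
      have : C ⊆ C ∆ D' ∪ D' := fun z hz => by
        simp only [mem_union, mem_symmDiff]; tauto
      exact (card_le_card this).trans (card_union_le _ _)
    omega

end basics
end LC
set_option linter.unusedSectionVars false
set_option linter.unusedVariables false
namespace LC
open Finset
open scoped symmDiff

section flows
variable {E V : Type*} [DecidableEq E] [DecidableEq V]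

/-- integer unit vector -/
def dz (a : V) : V → ℤ := fun v => if a = v then 1 else 0

/-- divergence of an integer edge function -/
def dv (s t : E → V) (L : Finset E) (p : E → ℤ) : V → ℤ :=
  fun v => ∑ e ∈ L, p e * (dz (s e) v - dz (t e) v)

/-- the edges of `L` crossing `A` -/
def cut (s t : E → V) (L : Finset E) (A : Finset V) : Finset E :=
  L.filter fun e => ¬ (s e ∈ A ↔ t e ∈ A)

variable {s t : E → V}

theorem reach [Fintype V] (L : Finset E) (ap am : E → Prop) (a : V) :
    ∃ S : Finset V, a ∈ S ∧
      (∀ v ∈ S, ∃ p : E → ℤ, (∀ e ∈ L, p e = 0 ∨ (p e = 1 ∧ ap e) ∨ (p e = -1 ∧ am e)) ∧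
        dv s t L p = dz a - dz v) ∧
      (∀ e ∈ L, ap e → s e ∈ S → t e ∈ S) ∧ (∀ e ∈ L, am e → t e ∈ S → s e ∈ S) := by
  have key : ∀ (n : ℕ) (S : Finset V), (univ \ S).card = n → a ∈ S →
      (∀ v ∈ S, ∃ p : E → ℤ, (∀ e ∈ L, p e = 0 ∨ (p e = 1 ∧ ap e) ∨ (p e = -1 ∧ am e)) ∧
        dv s t L p = dz a - dz v ∧ ∀ e, p e ≠ 0 → s e ∈ S ∧ t e ∈ S) →
      ∃ S : Finset V, a ∈ S ∧
      (∀ v ∈ S, ∃ p : E → ℤ, (∀ e ∈ L, p e = 0 ∨ (p e = 1 ∧ ap e) ∨ (p e = -1 ∧ am e)) ∧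
        dv s t L p = dz a - dz v) ∧
      (∀ e ∈ L, ap e → s e ∈ S → t e ∈ S) ∧ (∀ e ∈ L, am e → t e ∈ S → s e ∈ S) := by
    intro n
    induction n using Nat.strong_induction_on with
    | _ n ih =>
      intro S hn haS hS
      -- extension step
      have ext : ∀ (e : E) (he : e ∈ L) (u w : V) (hu : u ∈ S) (hw : w ∉ S) (c : ℤ)
          (hc : (c = 1 ∧ ap e ∧ s e = u ∧ t e = w) ∨ (c = -1 ∧ am e ∧ t e = u ∧ s e = w)),
          ∃ S : Finset V, a ∈ S ∧
            (∀ v ∈ S, ∃ p : E → ℤ, (∀ e ∈ L, p e = 0 ∨ (p e = 1 ∧ ap e) ∨ (p e = -1 ∧ am e)) ∧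
              dv s t L p = dz a - dz v) ∧
            (∀ e ∈ L, ap e → s e ∈ S → t e ∈ S) ∧ (∀ e ∈ L, am e → t e ∈ S → s e ∈ S) := by
        intro e he u w hu hw c hc
        refine ih (univ \ (insert w S)).card ?_ (insert w S) rfl (mem_insert_of_mem haS) ?_
        · rw [← hn]
          apply card_lt_card
          refine ⟨fun x hx => by simp at hx ⊢; tauto, fun h => ?_⟩
          have := h (show w ∈ univ \ S by simp [hw])
          simp at this
        · intro v hv
          rcases mem_insert.1 hv with rfl | hv
          · obtain ⟨p, hp1, hp2, hp3⟩ := hS u hu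
            have hpe : p e = 0 := by
              by_contra h
              have := hp3 e h
              rcases hc with ⟨_, _, _, h4⟩ | ⟨_, _, _, h4⟩
              · exact hw (h4 ▸ this.2)
              · exact hw (h4 ▸ this.1)
            refine ⟨Function.update p e c, ?_, ?_, ?_⟩
            · intro f hf
              by_cases hfe : f = e
              · subst hfe
                simp only [Function.update_self]
                tauto
              · simp only [Function.update_of_ne hfe]
                exact hp1 f hf
            · have h1 : dv s t L (Function.update p e c) = dv s t L p + c • (dz (s e) - dz (t e)) := by
                funext x
                simp only [dv, Pi.add_apply, Pi.smul_apply, Pi.sub_apply, smul_eq_mul]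
                rw [← add_sum_erase L _ he, ← add_sum_erase L (fun f => p f * _) he]
                have : ∑ f ∈ L.erase e, Function.update p e c f * (dz (s f) x - dz (t f) x)
                    = ∑ f ∈ L.erase e, p f * (dz (s f) x - dz (t f) x) := by
                  apply sum_congr rfl
                  intro f hf
                  rw [Function.update_of_ne (ne_of_mem_erase hf)]
                rw [this, Function.update_self, hpe]; ring
              rw [h1, hp2]
              rcases hc with ⟨h1, _, h3, h4⟩ | ⟨h1, _, h3, h4⟩
              · rw [h1, h3, h4]; module
              · rw [h1, h3, h4]; module
            · intro f hf
              by_cases hfe : f = e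
              · subst hfe
                rcases hc with ⟨_, _, h3, h4⟩ | ⟨_, _, h3, h4⟩
                · rw [h3, h4]; simp [hu]
                · rw [h3, h4]; simp [hu]
              · rw [Function.update_of_ne hfe] at hf
                have := hp3 f hf
                exact ⟨mem_insert_of_mem this.1, mem_insert_of_mem this.2⟩
          · obtain ⟨p, hp1, hp2, hp3⟩ := hS v hv
            exact ⟨p, hp1, hp2, fun f hf =>
              ⟨mem_insert_of_mem (hp3 f hf).1, mem_insert_of_mem (hp3 f hf).2⟩⟩
      by_cases h1 : ∀ e ∈ L, ap e → s e ∈ S → t e ∈ S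
      · by_cases h2 : ∀ e ∈ L, am e → t e ∈ S → s e ∈ S
        · refine ⟨S, haS, fun v hv => ?_, h1, h2⟩
          obtain ⟨p, hp1, hp2, _⟩ := hS v hv
          exact ⟨p, hp1, hp2⟩
        · push Not at h2
          obtain ⟨e, he, h3, h4, h5⟩ := h2
          exact ext e he _ _ h4 h5 (-1) (Or.inr ⟨rfl, h3, rfl, rfl⟩)
      · push Not at h1
        obtain ⟨e, he, h3, h4, h5⟩ := h1
        exact ext e he _ _ h4 h5 1 (Or.inl ⟨rfl, h3, rfl, rfl⟩)
  refine key _ {a} rfl (by simp) ?_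
  intro v hv
  rw [mem_singleton] at hv
  subst hv
  refine ⟨fun _ => 0, fun _ _ => Or.inl rfl, ?_, fun e h => absurd rfl h⟩
  funext x; simp [dv]

theorem dz_cast (a v : V) : ((dz a v : ℤ) : ZMod 2) = dl a v := by
  unfold dz dl; split_ifs <;> simp

theorem bd_supp (L : Finset E) (p : E → ℤ) (hp : ∀ e ∈ L, p e = 0 ∨ p e = 1 ∨ p e = -1) :
    bd s t (L.filter fun e => p e ≠ 0) = fun v => ((dv s t L p v : ℤ) : ZMod 2) := by
  funext v
  rw [bd_apply, dv, sum_filter]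
  push_cast
  apply sum_congr rfl
  intro e he
  simp only [dz_cast]
  rcases hp e he with h | h | h
  · simp [h]
  · simp [h, inc, CharTwo.sub_eq_add]
  · simp [h, inc, CharTwo.sub_eq_add, CharTwo.neg_eq]

theorem bd_supp' (L : Finset E) (p : E → ℤ) (hp : ∀ e ∈ L, p e = 0 ∨ p e = 1 ∨ p e = -1)
    {a b : V} (h : dv s t L p = dz a - dz b) :
    bd s t (L.filter fun e => p e ≠ 0) = dl a + dl b := by
  rw [bd_supp L p hp, h]
  funext v
  simp [dz_cast, CharTwo.sub_eq_add]

theorem sum_dz (A : Finset V) (a : V) : ∑ v ∈ A, dz a v = if a ∈ A then 1 else 0 := by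
  simp [dz]

theorem sum_dv (L : Finset E) (p : E → ℤ) (A : Finset V) :
    ∑ v ∈ A, dv s t L p v =
      ∑ e ∈ L, p e * ((if s e ∈ A then 1 else 0) - (if t e ∈ A then 1 else 0)) := by
  unfold dv
  rw [sum_comm]
  apply sum_congr rfl
  intro e _
  rw [← mul_sum, sum_sub_distrib, sum_dz, sum_dz]

theorem decomp [Fintype V] (L : Finset E) {a b : V} (m : ℕ) (g : E → ℤ)
    (hg : ∀ e ∈ L, g e = 0 ∨ g e = 1 ∨ g e = -1)
    (hd : dv s t L g = (m : ℤ) • (dz a - dz b)) :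
    ∃ P : ℕ → Finset E, (∀ j < m, P j ⊆ L.filter (fun e => g e ≠ 0) ∧
      bd s t (P j) = dl a + dl b) ∧ ∀ i < m, ∀ j < m, i ≠ j → Disjoint (P i) (P j) := by
  induction m generalizing g with
  | zero => exact ⟨fun _ => ∅, by simp, by simp⟩
  | succ m ih =>
    obtain ⟨S, haS, hS, h1, h2⟩ := reach (s := s) (t := t) L (fun e => g e = 1) (fun e => g e = -1) a
    have hbS : b ∈ S := by
      by_contra hb
      have h3 := sum_dv (s := s) (t := t) L g S
      have h4 : ∑ v ∈ S, dv s t L g v = m + 1 := by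
        rw [hd]
        simp only [Pi.smul_apply, Pi.sub_apply, ← smul_sum, sum_sub_distrib, sum_dz]
        simp [haS, hb]
      have h5 : ∑ e ∈ L, g e * ((if s e ∈ S then 1 else 0) - (if t e ∈ S then 1 else 0)) ≤ 0 := by
        apply sum_nonpos
        intro e he
        have := h1 e he
        have := h2 e he
        rcases hg e he with h | h | h <;> simp only [h] <;> split_ifs <;> simp_all
      omega
    obtain ⟨p, hp1, hp2⟩ := hS b hbS
    obtain ⟨P, hP1, hP2⟩ := ih (fun e => g e - p e) (by
        intro e he
        have := hg e he
        rcases hp1 e he with h | h | h <;> simp_all) (by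
        have : dv s t L (fun e => g e - p e) = dv s t L g - dv s t L p := by
          funext v
          simp [dv, sub_mul, sum_sub_distrib]
        rw [this, hd, hp2]; push_cast; module)
    have hpp : ∀ e ∈ L, p e = 0 ∨ p e = 1 ∨ p e = -1 := fun e he => by
      have := hp1 e he; tauto
    refine ⟨fun j => if j < m then P j else L.filter fun e => p e ≠ 0, ?_, ?_⟩
    · intro j hj
      by_cases hjm : j < m
      · simp only [hjm, if_true]
        refine ⟨fun e he => ?_, (hP1 j hjm).2⟩
        have := (hP1 j hjm).1 he
        rw [mem_filter] at this ⊢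
        refine ⟨this.1, fun h0 => this.2 ?_⟩
        rcases hp1 e this.1 with h | h | h
        · simp [h, h0]
        · exfalso; have := h.2; omega
        · exfalso; have := h.2; omega
      · simp only [hjm, if_false]
        refine ⟨fun e he => ?_, bd_supp' L p hpp hp2⟩
        rw [mem_filter] at he ⊢
        refine ⟨he.1, fun h0 => he.2 ?_⟩
        rcases hp1 e he.1 with h | h | h
        · exact h
        · exfalso; have := h.2; omega
        · exfalso; have := h.2; omega
    · have hdis : ∀ j < m, Disjoint (P j) (L.filter fun e => p e ≠ 0) := by
        intro j hj
        rw [Finset.disjoint_left]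
        intro e he he'
        have h3 := (hP1 j hj).1 he
        rw [mem_filter] at h3 he'
        apply h3.2
        rcases hp1 e h3.1 with h | h | h
        · exact absurd h he'.2
        · rw [h.1, h.2]; rfl
        · rw [h.1, h.2]; rfl
      intro i hi j hj hij
      by_cases him : i < m <;> by_cases hjm : j < m
      · simp only [him, hjm, if_true]; exact hP2 i him j hjm hij
      · simp only [him, hjm, if_true, if_false]; exact hdis i him
      · simp only [him, hjm, if_true, if_false]; exact (hdis j hjm).symm
      · omega

theorem menger [Fintype V] (L : Finset E) {a b : V} (hab : a ≠ b) (k : ℕ) :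
    (∃ P : ℕ → Finset E, (∀ j < k, P j ⊆ L ∧ bd s t (P j) = dl a + dl b) ∧
      ∀ i < k, ∀ j < k, i ≠ j → Disjoint (P i) (P j)) ∨
    ∃ A : Finset V, a ∈ A ∧ b ∉ A ∧ (cut s t L A).card < k := by
  by_cases hcut : ∃ A : Finset V, a ∈ A ∧ b ∉ A ∧ (cut s t L A).card < k
  · exact Or.inr hcut
  left
  have hflow : ∀ m ≤ k, ∃ g : E → ℤ, (∀ e ∈ L, g e = 0 ∨ g e = 1 ∨ g e = -1) ∧
      dv s t L g = (m : ℤ) • (dz a - dz b) := by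
    intro m
    induction m with
    | zero =>
      intro _
      refine ⟨fun _ => 0, by simp, ?_⟩
      funext v; simp [dv]
    | succ m ih =>
      intro hm
      obtain ⟨g, hg, hd⟩ := ih (by omega)
      obtain ⟨S, haS, hS, h1, h2⟩ := reach (s := s) (t := t) L (fun e => g e ≤ 0) (fun e => 0 ≤ g e) a
      by_cases hb : b ∈ S
      · obtain ⟨p, hp1, hp2⟩ := hS b hb
        refine ⟨fun e => g e + p e, ?_, ?_⟩
        · intro e he
          have h3 := hg e he
          have h4 := hp1 e he
          dsimp only
          omega
        · have : dv s t L (fun e => g e + p e) = dv s t L g + dv s t L p := by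
            funext v
            simp [dv, add_mul, sum_add_distrib]
          rw [this, hd, hp2]; push_cast; module
      · exfalso
        apply hcut
        refine ⟨S, haS, hb, ?_⟩
        have h3 := sum_dv (s := s) (t := t) L g S
        have h4 : ∑ v ∈ S, dv s t L g v = m := by
          rw [hd]
          simp only [Pi.smul_apply, Pi.sub_apply, ← smul_sum, sum_sub_distrib, sum_dz]
          simp [haS, hb]
        have h5 : ∑ e ∈ L, g e * ((if s e ∈ S then 1 else 0) - (if t e ∈ S then 1 else 0))
            = ((cut s t L S).card : ℤ) := by
          unfold cut
          rw [card_filter]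
          push_cast
          apply sum_congr rfl
          intro e he
          have h6 := h1 e he
          have h7 := h2 e he
          have h8 := hg e he
          by_cases hs : s e ∈ S <;> by_cases ht : t e ∈ S
          · simp [hs, ht]
          · have h9 : ¬ g e ≤ 0 := fun h => ht (h6 h hs)
            simp [hs, ht]; omega
          · have h9 : ¬ 0 ≤ g e := fun h => hs (h7 h ht)
            simp [hs, ht]; omega
          · simp [hs, ht]
        omega
  obtain ⟨g, hg, hd⟩ := hflow k le_rfl
  obtain ⟨P, hP1, hP2⟩ := decomp L k g hg hd
  exact ⟨P, fun j hj => ⟨(hP1 j hj).1.trans (filter_subset _ _), (hP1 j hj).2⟩, hP2⟩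

theorem sum_bd (F : Finset E) (A : Finset V) :
    ∑ v ∈ A, bd s t F v = ∑ e ∈ F, (if ¬ (s e ∈ A ↔ t e ∈ A) then (1 : ZMod 2) else 0) := by
  simp only [bd_apply]
  rw [sum_comm]
  apply sum_congr rfl
  intro e _
  have : ∀ a : V, ∑ v ∈ A, dl a v = if a ∈ A then 1 else 0 := fun a => by simp [dl]
  simp only [inc, Pi.add_apply, sum_add_distrib, this]
  by_cases hs : s e ∈ A <;> by_cases ht : t e ∈ A <;> simp [hs, ht, two_zero]

/-- circuits are connected -/
theorem Circ.conn [Fintype V] {C : Finset E} (hC : Circ s t C) {e f : E} (he : e ∈ C) (hf : f ∈ C)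
    {w : V} (hw : s f = w ∨ t f = w) : ∃ q ⊆ C, bd s t q = dl (s e) + dl w := by
  obtain ⟨S, haS, hS, h1, h2⟩ := reach (s := s) (t := t) C (fun _ => True) (fun _ => True) (s e)
  have hD : Ev s t (C.filter fun f => s f ∈ S) := by
    funext v
    rw [bd_apply, sum_filter]
    by_cases hv : v ∈ S
    · rw [← congrFun hC.2.1 v, bd_apply]
      apply sum_congr rfl
      intro f hf
      have h3 := h1 f hf trivial
      have h4 := h2 f hf trivial
      split_ifs with h
      · rfl
      · have hs : s f ≠ v := fun h' => h (h' ▸ hv)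
        have ht : t f ≠ v := fun h' => h (h4 (h' ▸ hv))
        simp [inc, dl, hs, ht]
    · apply sum_eq_zero
      intro f hf
      have h3 := h1 f hf trivial
      split_ifs with h
      · have hs : s f ≠ v := fun h' => hv (h' ▸ h)
        have ht : t f ≠ v := fun h' => hv (h' ▸ h3 h)
        simp [inc, dl, hs, ht]
      · rfl
  have hDC := hC.2.2 _ (filter_subset _ _) ⟨e, by simp [he, haS]⟩ hD
  have hfS : s f ∈ S := by
    have : f ∈ C.filter fun f => s f ∈ S := by rw [hDC]; exact hf
    exact (mem_filter.1 this).2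
  have hwS : w ∈ S := by
    rcases hw with h | h
    · exact h ▸ hfS
    · exact h ▸ h1 f hf trivial hfS
  obtain ⟨p, hp1, hp2⟩ := hS w hwS
  exact ⟨_, filter_subset _ _, bd_supp' C p (fun e he => by have := hp1 e he; tauto) hp2⟩

end flows
end LC
set_option linter.unusedSectionVars false
set_option linter.unusedVariables false
namespace LC
open Finset
open scoped symmDiff

section lumps
variable {E V : Type*} [DecidableEq E] [DecidableEq V]

/-- `w` can be reached from `r` by an edge set of size at most `n` inside `K` -/
def Rch (s t : E → V) (r : V) (K : Finset E) (n : ℕ) (w : V) : Prop :=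
  ∃ q ⊆ K, bd s t q = dl r + dl w ∧ q.card ≤ n

variable {s t : E → V}

theorem Rch.mono {r w : V} {K K' : Finset E} {n m : ℕ} (h : Rch s t r K n w) (hK : K ⊆ K')
    (hn : n ≤ m) : Rch s t r K' m w := by
  obtain ⟨q, h1, h2, h3⟩ := h
  exact ⟨q, h1.trans hK, h2, h3.trans hn⟩

theorem bd_insert {q : Finset E} {f : E} (hf : f ∉ q) : bd s t (insert f q) = inc s t f + bd s t q := by
  unfold bd; rw [sum_insert hf]

theorem inc_ne {f : E} {w : V} (h : inc s t f w ≠ 0) :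
    (s f = w ∧ t f ≠ w) ∨ (s f ≠ w ∧ t f = w) := by
  by_cases h1 : s f = w <;> by_cases h2 : t f = w
  · exfalso; apply h; simp [inc, dl, h1, h2, two_zero]
  · exact Or.inl ⟨h1, h2⟩
  · exact Or.inr ⟨h1, h2⟩
  · exfalso; apply h; simp [inc, dl, h1, h2]

theorem allShort_of_reach {l : ℕ} (hl : 1 ≤ l) {L : Finset E} (r : V) (hgap : Gap s t l L)
    (hr : ∀ f ∈ L, ∀ w, (s f = w ∨ t f = w) → Rch s t r L l w) : AllShort s t l L := by
  classical
  let good : Finset E → Prop := fun K => AllShort s t l K ∧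
    ∀ f ∈ K, ∀ w, (s f = w ∨ t f = w) → ∀ n, Rch s t r L n w → Rch s t r K n w
  have hne : (L.powerset.filter good).Nonempty := by
    refine ⟨∅, ?_⟩
    rw [mem_filter]
    refine ⟨by simp, ?_, by simp⟩
    intro C hC hCc
    obtain ⟨x, hx⟩ := hCc.1
    exact absurd (hC hx) (by simp)
  obtain ⟨K, hK, hmax⟩ := exists_max_image _ Finset.card hne
  rw [mem_filter, mem_powerset] at hK
  obtain ⟨hKL, hKs, hKr⟩ := hK
  have hmax' : ∀ f ∈ L, f ∉ K → ¬ good (insert f K) := by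
    intro f hf hfK hg
    have := hmax (insert f K) (by
      rw [mem_filter, mem_powerset]; exact ⟨insert_subset hf hKL, hg⟩)
    rw [card_insert_of_notMem hfK] at this
    omega
  by_cases hA : ∃ n, ∃ w, Rch s t r L n w ∧ ¬ Rch s t r K n w
  · exfalso
    obtain ⟨w, hw1, hw2⟩ := Nat.find_spec hA
    set n := Nat.find hA with hn
    have hmin : ∀ m < n, ∀ v, Rch s t r L m v → Rch s t r K m v := by
      intro m hm v hv
      by_contra h
      exact Nat.find_min hA hm ⟨v, hv, h⟩
    have hwr : r ≠ w := by
      rintro rfl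
      exact hw2 ⟨∅, by simp, by rw [bd_empty, two_zero'], by simp⟩
    have hwK : ∀ g ∈ K, s g ≠ w ∧ t g ≠ w := fun g hg =>
      ⟨fun h => hw2 (hKr g hg w (Or.inl h) n hw1), fun h => hw2 (hKr g hg w (Or.inr h) n hw1)⟩
    obtain ⟨q, hq1, hq2, hq3⟩ := hw1
    have hqw : bd s t q w ≠ 0 := by
      rw [hq2]; simp [dl, hwr]
    rw [bd_apply] at hqw
    obtain ⟨f, hf, hfw⟩ := exists_ne_zero_of_sum_ne_zero hqw
    have hfK : f ∉ K := fun h => by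
      have := hwK f h
      rcases inc_ne hfw with h1 | h1
      · exact this.1 h1.1
      · exact this.2 h1.2
    obtain ⟨x, hxw, hfx, hends⟩ : ∃ x, x ≠ w ∧ inc s t f = dl x + dl w ∧
        ∀ v, (s f = v ∨ t f = v) → v = x ∨ v = w := by
      rcases inc_ne hfw with h1 | h1
      · exact ⟨t f, h1.2, by rw [inc, h1.1, add_comm], by
          rintro v (h | h)
          · right; rw [← h, h1.1]
          · left; exact h.symm⟩
      · exact ⟨s f, h1.1, by rw [inc, h1.2], by
          rintro v (h | h)
          · left; exact h.symm
          · right; rw [← h, h1.2]⟩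
    have hqpos : 0 < q.card := card_pos.2 ⟨f, hf⟩
    have hx : Rch s t r L (n - 1) x := by
      refine ⟨q.erase f, (erase_subset _ _).trans hq1, ?_, by rw [card_erase_of_mem hf]; omega⟩
      have h1 := bd_insert (s := s) (t := t) (notMem_erase f q)
      rw [insert_erase hf, hq2, hfx] at h1
      have : bd s t (q.erase f) = dl x + dl w + (dl x + dl w + bd s t (q.erase f)) := by
        rw [← add_assoc, two_zero', zero_add]
      rw [this, ← h1]
      calc _ = dl r + dl x + (dl w + dl w) := by abel
        _ = _ := by rw [two_zero', add_zero]
    have hxK := hmin (n - 1) (by omega) x hx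
    refine hmax' f (hq1 hf) hfK ⟨?_, ?_⟩
    · intro C hC hCc
      by_cases hfC : f ∈ C
      · exfalso
        have h1 := congrFun hCc.2.1 w
        rw [bd_apply, sum_eq_single_of_mem f hfC] at h1
        · exact hfw h1
        · intro g hg hgf
          have hgK : g ∈ K := (mem_insert.1 (hC hg)).resolve_left hgf
          have := hwK g hgK
          simp [inc, dl, this.1, this.2]
      · exact hKs C (fun y hy => (mem_insert.1 (hC hy)).resolve_left fun h => hfC (h ▸ hy)) hCc
    · intro g hg v hv m hm
      rcases mem_insert.1 hg with rfl | hg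
      · rcases hends v hv with rfl | rfl
        · by_cases hmn : m < n
          · exact (hmin m hmn _ hm).mono (subset_insert _ _) le_rfl
          · exact hxK.mono (subset_insert _ _) (by omega)
        · by_cases hmn : m < n
          · exact (hmin m hmn _ hm).mono (subset_insert _ _) le_rfl
          · obtain ⟨p, hp1, hp2, hp3⟩ := hxK
            have hgp : g ∉ p := fun h => hfK (hp1 h)
            refine ⟨insert g p, insert_subset_insert _ hp1, ?_, ?_⟩
            · rw [bd_insert hgp, hp2, hfx]
              calc _ = dl r + dl v + (dl x + dl x) := by abel
                _ = _ := by rw [two_zero', add_zero]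
            · rw [card_insert_of_notMem hgp]; omega
      · exact (hKr g hg v hv m hm).mono (subset_insert _ _) le_rfl
  · push Not at hA
    by_cases hKe : K = L
    · rw [← hKe]; exact hKs
    exfalso
    obtain ⟨f, hf, hfK⟩ : ∃ f ∈ L, f ∉ K := by
      by_contra h
      push Not at h
      exact hKe (hKL.antisymm h)
    obtain ⟨q1, hq1, hq1b, hq1c⟩ := hA l _ (hr f hf _ (Or.inl rfl))
    obtain ⟨q2, hq2, hq2b, hq2c⟩ := hA l _ (hr f hf _ (Or.inr rfl))
    have hsub : q1 ∆ q2 ⊆ K := symmDiff_subset_union.trans (union_subset hq1 hq2)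
    have hfq : f ∉ q1 ∆ q2 := fun h => hfK (hsub h)
    have hev : Ev s t (insert f (q1 ∆ q2)) := by
      unfold Ev
      rw [bd_insert hfq, bd_symmDiff, hq1b, hq2b, inc]
      calc _ = (dl r + dl r) + (dl (s f) + dl (s f)) + (dl (t f) + dl (t f)) := by abel
        _ = _ := by simp only [two_zero', add_zero]
    obtain ⟨D, hD, hDc, hfD⟩ := hev.exists_circ (mem_insert_self _ _)
    have hDK : D ⊆ insert f K := hD.trans (insert_subset_insert _ hsub)
    have hKL' : insert f K ⊆ L := insert_subset hf hKL
    have hcard : D.card ≤ 2 * l + 1 := by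
      refine (card_le_card hD).trans ?_
      rw [card_insert_of_notMem hfq]
      have := card_le_card (symmDiff_subset_union : q1 ∆ q2 ⊆ q1 ∪ q2)
      have := card_union_le q1 q2
      omega
    have hDs : D.card < l := hgap D (hDK.trans hKL') hDc (by omega)
    refine hmax' f hf hfK ⟨allShort_insert hfK hKs (hgap.mono hKL') hDc hDK hfD hDs, ?_⟩
    intro g hg v hv m hm
    exact (hA m v hm).mono (subset_insert _ _) le_rfl

/-- lump relation -/
def Sim (s t : E → V) (l : ℕ) (G : Finset E) (e f : E) : Prop :=
  e = f ∨ ∃ C ⊆ G, Circ s t C ∧ C.card < l ∧ e ∈ C ∧ f ∈ C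

theorem Sim.symm {l : ℕ} {G : Finset E} {e f : E} (h : Sim s t l G e f) : Sim s t l G f e := by
  rcases h with h | ⟨C, h1, h2, h3, h4, h5⟩
  · exact Or.inl h.symm
  · exact Or.inr ⟨C, h1, h2, h3, h5, h4⟩

theorem Sim.trans {l : ℕ} {G : Finset E} (hgap : Gap s t l G) {e f g : E} (h : Sim s t l G e f)
    (h' : Sim s t l G f g) : Sim s t l G e g := by
  rcases h with rfl | ⟨C, h1, h2, h3, h4, h5⟩
  · exact h'
  rcases h' with rfl | ⟨D, k1, k2, k3, k4, k5⟩
  · exact Or.inr ⟨C, h1, h2, h3, h4, h5⟩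
  obtain ⟨B, hB, hBc, he, hg⟩ := circ_trans h2 k2 h4 k5 ⟨f, mem_inter.2 ⟨h5, k4⟩⟩
  have hBG := hB.trans (union_subset h1 k1)
  refine Or.inr ⟨B, hBG, hBc, hgap B hBG hBc ?_, he, hg⟩
  have := card_le_card hB
  have := card_union_le C D
  omega

open Classical in
/-- the lump of `e` -/
noncomputable def lab (s t : E → V) (l : ℕ) (G : Finset E) (e : E) : Finset E :=
  G.filter fun f => Sim s t l G e f

theorem mem_lab {l : ℕ} {G : Finset E} {e f : E} : f ∈ lab s t l G e ↔ f ∈ G ∧ Sim s t l G e f := by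
  simp [lab]

theorem lab_eq {l : ℕ} {G : Finset E} (hgap : Gap s t l G) {e f : E} (h : Sim s t l G e f) :
    lab s t l G e = lab s t l G f := by
  ext g
  rw [mem_lab, mem_lab]
  exact ⟨fun h' => ⟨h'.1, h.symm.trans hgap h'.2⟩, fun h' => ⟨h'.1, h.trans hgap h'.2⟩⟩

theorem circ_sub_lab {l : ℕ} {G : Finset E} {C : Finset E} (hC : C ⊆ G) (hCc : Circ s t C)
    (hCl : C.card < l) {e : E} (he : e ∈ C) : C ⊆ lab s t l G e := fun f hf =>
  mem_lab.2 ⟨hC hf, Or.inr ⟨C, hC, hCc, hCl, he, hf⟩⟩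

theorem lab_reach [Fintype V] {l : ℕ} (hl : 1 ≤ l) {G : Finset E} (hgap : Gap s t l G) (e : E) (he : e ∈ G) :
    ∀ f ∈ lab s t l G e, ∀ w, (s f = w ∨ t f = w) → Rch s t (s e) (lab s t l G e) l w := by
  intro f hf w hw
  rw [mem_lab] at hf
  rcases hf.2 with rfl | ⟨C, h1, h2, h3, h4, h5⟩
  · rcases hw with rfl | rfl
    · exact ⟨∅, by simp, by rw [bd_empty, two_zero'], by simp⟩
    · exact ⟨{e}, by simp [mem_lab, he, Sim], by simp [bd, inc], by simp [hl]⟩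
  · obtain ⟨q, hq, hqb⟩ := h2.conn h4 h5 hw
    exact ⟨q, hq.trans (circ_sub_lab h1 h2 h3 h4), hqb, (card_le_card hq).trans h3.le⟩

theorem lab_allShort [Fintype V] {l : ℕ} (hl : 1 ≤ l) {G : Finset E} (hgap : Gap s t l G) (e : E) (he : e ∈ G) :
    AllShort s t l (lab s t l G e) :=
  allShort_of_reach hl (s e) (hgap.mono (by simp [lab])) (lab_reach hl hgap e he)

end lumps
end LC
set_option linter.unusedSectionVars false
set_option linter.unusedVariables false
namespace LC
open Finset
open scoped symmDiff

section bip

open Classical in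
theorem not_acyclic {U : Type*} [Fintype U] (B : SimpleGraph U)
    (h : ∀ x, Even (univ.filter fun y => B.Adj x y).card) {x y : U} (hxy : B.Adj x y) :
    ¬ B.IsAcyclic := by
  intro hac
  have hb := SimpleGraph.isAcyclic_iff_forall_adj_isBridge.1 hac hxy
  rw [SimpleGraph.isBridge_iff] at hb
  set B' := B.deleteEdges {s(x, y)} with hB'
  have hB'a : ∀ u v, B'.Adj u v ↔ B.Adj u v ∧ ¬ ((u = x ∧ v = y) ∨ (u = y ∧ v = x)) := by
    intro u v
    simp [hB', SimpleGraph.deleteEdges_adj]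
  have hnr : ¬ B'.Reachable x y := by
    exact hb
  let H : SimpleGraph U :=
    { Adj := fun u v => B'.Adj u v ∧ B'.Reachable x u
      symm := ⟨fun u v huv => ⟨huv.1.symm, huv.2.trans huv.1.reachable⟩⟩
      loopless := ⟨fun u hu => B'.loopless.irrefl u hu.1⟩ }
  have hdeg : ∀ w, H.degree w = (univ.filter fun y => H.Adj w y).card := by
    intro w
    rw [← SimpleGraph.card_neighborFinset_eq_degree, SimpleGraph.neighborFinset_eq_filter]
  have hx : Odd (H.degree x) := by
    rw [hdeg]
    have h1 : (univ.filter fun z => B.Adj x z) = insert y (univ.filter fun z => H.Adj x z) := by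
      ext z
      simp only [mem_filter, mem_univ, true_and, mem_insert]
      constructor
      · intro hz
        by_cases hzy : z = y
        · exact Or.inl hzy
        · refine Or.inr ⟨(hB'a _ _).2 ⟨hz, ?_⟩, SimpleGraph.Reachable.refl _⟩
          rintro (h1 | h1)
          · exact hzy h1.2
          · exact hxy.ne h1.1
      · rintro (rfl | hz)
        · exact hxy
        · exact ((hB'a _ _).1 hz.1).1
    have h2 := h x
    rw [h1, card_insert_of_notMem] at h2
    · exact (Nat.even_add_one.1 h2 |> Nat.not_even_iff_odd.1)
    · simp only [mem_filter, mem_univ, true_and]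
      intro hz
      exact ((hB'a _ _).1 hz.1).2 (Or.inl ⟨rfl, rfl⟩)
  obtain ⟨w, hwx, hw⟩ := H.exists_ne_odd_degree_of_exists_odd_degree x hx
  rw [hdeg] at hw
  by_cases hwr : B'.Reachable x w
  · have hwy : w ≠ y := fun h => hnr (h ▸ hwr)
    have h1 : (univ.filter fun z => H.Adj w z) = (univ.filter fun z => B.Adj w z) := by
      ext z
      simp only [mem_filter, mem_univ, true_and]
      constructor
      · intro hz; exact ((hB'a _ _).1 hz.1).1
      · intro hz
        exact ⟨(hB'a _ _).2 ⟨hz, by simp [hwx, hwy]⟩, hwr⟩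
    rw [h1] at hw
    exact Nat.not_even_iff_odd.2 hw (h w)
  · have h1 : (univ.filter fun z => H.Adj w z) = ∅ := by
      rw [filter_eq_empty_iff]
      intro z _ hz
      exact hwr hz.2
    rw [h1] at hw
    simp at hw

open Classical in
theorem bip_cycle {V I : Type*} [DecidableEq V] [Fintype V] [Fintype I] (R : V → I → Prop)
    (h1 : ∀ v, Even (univ.filter fun i => R v i).card)
    (h2 : ∀ i, Even (univ.filter fun v => R v i).card)
    (hne : ∃ v i, R v i) :
    ∃ (J : Finset I) (a b : I → V), J.Nonempty ∧ (∀ i ∈ J, a i ≠ b i ∧ R (a i) i ∧ R (b i) i) ∧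
      ∑ i ∈ J, (dl (a i) + dl (b i)) = 0 := by
  let B : SimpleGraph (V ⊕ I) :=
    { Adj := fun x y => match x, y with
        | Sum.inl v, Sum.inr i => R v i
        | Sum.inr i, Sum.inl v => R v i
        | _, _ => False
      symm := ⟨by rintro (v | i) (w | j) <;> simp⟩
      loopless := ⟨by rintro (v | i) <;> simp⟩ }
  have b1 : ∀ v i, B.Adj (Sum.inl v) (Sum.inr i) ↔ R v i := fun v i => Iff.rfl
  have b2 : ∀ v i, B.Adj (Sum.inr i) (Sum.inl v) ↔ R v i := fun v i => Iff.rfl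
  have b3 : ∀ v w, ¬ B.Adj (Sum.inl v) (Sum.inl w) := fun v i h => h
  have b4 : ∀ v w, ¬ B.Adj (Sum.inr v) (Sum.inr w) := fun v i h => h
  obtain ⟨v0, i0, h0⟩ := hne
  have hna := not_acyclic B (by
    rintro (v | i)
    · have : (univ.filter fun y => B.Adj (Sum.inl v) y)
          = (univ.filter fun i => R v i).map Function.Embedding.inr := by
        ext (w | j)
        · simp [b3]
        · simp [b1]
      rw [this, card_map]; exact h1 v
    · have : (univ.filter fun y => B.Adj (Sum.inr i) y)
          = (univ.filter fun v => R v i).map Function.Embedding.inl := by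
        ext (w | j)
        · simp [b2]
        · simp [b4]
      rw [this, card_map]; exact h2 i) ((b1 v0 i0).2 h0)
  simp only [SimpleGraph.IsAcyclic] at hna
  push Not at hna
  obtain ⟨x, c, hc⟩ := hna
  have hdeg : ∀ z ∈ c.support, (c.toSubgraph.neighborSet z).ncard = 2 := fun z hz =>
    hc.ncard_neighborSet_toSubgraph_eq_two hz
  have hi : ∀ i, Sum.inr i ∈ c.support → ∃ a b : V, a ≠ b ∧
      ∀ v, c.toSubgraph.Adj (Sum.inl v) (Sum.inr i) ↔ v = a ∨ v = b := by
    intro i hi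
    obtain ⟨a, b, hab, hs⟩ := Set.ncard_eq_two.1 (hdeg _ hi)
    have hmem : ∀ z, c.toSubgraph.Adj (Sum.inr i) z ↔ z = a ∨ z = b := by
      intro z
      have : z ∈ c.toSubgraph.neighborSet (Sum.inr i) ↔ z ∈ ({a, b} : Set (V ⊕ I)) := by rw [hs]
      simpa using this
    have ha := ((hmem a).2 (Or.inl rfl)).adj_sub
    have hb := ((hmem b).2 (Or.inr rfl)).adj_sub
    rcases a with a | a
    · rcases b with b | b
      · refine ⟨a, b, fun h => hab (by rw [h]), fun v => ?_⟩
        rw [SimpleGraph.Subgraph.adj_comm, hmem]; simp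
      · exact absurd hb (b4 _ _)
    · exact absurd ha (b4 _ _)
  have hv0 : Nonempty V := ⟨v0⟩
  let a : I → V := fun i => if h : Sum.inr i ∈ c.support then (hi i h).choose else v0
  let b : I → V := fun i => if h : Sum.inr i ∈ c.support then (hi i h).choose_spec.choose else v0
  have hab : ∀ i, Sum.inr i ∈ c.support → a i ≠ b i ∧
      ∀ v, c.toSubgraph.Adj (Sum.inl v) (Sum.inr i) ↔ v = a i ∨ v = b i := by
    intro i h
    simp only [a, b, dif_pos h]
    exact (hi i h).choose_spec.choose_spec
  refine ⟨univ.filter fun i => Sum.inr i ∈ c.support, a, b, ?_, ?_, ?_⟩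
  · rcases x with x | i
    · have := hdeg _ c.start_mem_support
      obtain ⟨a', b', hab, hs⟩ := Set.ncard_eq_two.1 this
      have hz : c.toSubgraph.Adj (Sum.inl x) a' := by
        have : a' ∈ c.toSubgraph.neighborSet (Sum.inl x) := by rw [hs]; simp
        simpa using this
      rcases a' with a' | a'
      · exact absurd hz.adj_sub (b3 _ _)
      · refine ⟨a', ?_⟩
        simp only [mem_filter, mem_univ, true_and]
        have := hz.snd_mem
        simpa using this
    · exact ⟨i, by simp⟩
  · intro i hi
    simp only [mem_filter, mem_univ, true_and] at hi
    obtain ⟨h3, h4⟩ := hab i hi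
    exact ⟨h3, ((h4 _).2 (Or.inl rfl)).adj_sub, ((h4 _).2 (Or.inr rfl)).adj_sub⟩
  · funext v
    rw [Finset.sum_apply]
    have : ∀ i ∈ univ.filter (fun i => Sum.inr i ∈ c.support),
        (dl (a i) + dl (b i)) v = if c.toSubgraph.Adj (Sum.inl v) (Sum.inr i) then 1 else 0 := by
      intro i hi
      simp only [mem_filter, mem_univ, true_and] at hi
      obtain ⟨h3, h4⟩ := hab i hi
      simp only [h4, dl, Pi.add_apply]
      by_cases ha : a i = v
      · have hb : b i ≠ v := fun h => h3 (ha.trans h.symm)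
        simp [ha, hb]
      · by_cases hb : b i = v
        · simp [ha, hb]
        · simp [ha, hb, Ne.symm ha, Ne.symm hb]
    rw [sum_congr rfl this, sum_boole]
    by_cases hv : Sum.inl v ∈ c.support
    · have h3 := hdeg _ hv
      have h4 : c.toSubgraph.neighborSet (Sum.inl v) = 
        (((univ.filter (fun i : I => Sum.inr i ∈ c.support)).filter 
          (fun i => c.toSubgraph.Adj (Sum.inl v) (Sum.inr i))).map 
            (Function.Embedding.inr : I ↪ V ⊕ I) : Finset (V ⊕ I)) := by
        ext z
        rcases z with w | j
        · simp
          intro h; exact b3 _ _ h.adj_sub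
        · simp
          intro h
          simpa using h.snd_mem
      rw [h4, Set.ncard_coe_finset, card_map] at h3
      rw [h3]; rfl
    · rw [filter_eq_empty_iff.2]
      · simp
      · intro i _ h
        exact hv (by simpa using h.fst_mem)

end bip
end LC
set_option linter.unusedSectionVars false
set_option linter.unusedVariables false
namespace LC
open Finset
open scoped symmDiff

section step
variable {E V : Type*} [DecidableEq E] [DecidableEq V]

/-- parity of the intersection -/
def par (Y F : Finset E) : ZMod 2 := ∑ e ∈ F, if e ∈ Y then 1 else 0

variable {s t : E → V}

theorem sum_zero_of_circ {M : Type*} [AddCommGroup M] (w : E → M) {F : Finset E} (hF : Ev s t F)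
    (h : ∀ D ⊆ F, Circ s t D → ∑ e ∈ D, w e = 0) : ∑ e ∈ F, w e = 0 := by
  induction F using Finset.strongInduction with
  | H F ih =>
    rcases F.eq_empty_or_nonempty with rfl | ⟨x, hx⟩
    · simp
    obtain ⟨D, hD, hDc, hxD⟩ := hF.exists_circ hx
    have := ih (F \ D) ⟨sdiff_subset, fun h' => (mem_sdiff.1 (h' hx)).2 hxD⟩ (hF.sdiff hDc.2.1 hD)
      (fun D' hD' => h D' (hD'.trans sdiff_subset))
    rw [← sum_sdiff hD, this, h D hD hDc, add_zero]

theorem zmod2_ne {x : ZMod 2} (h : x ≠ 0) : x = 1 := by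
  revert x; decide

theorem ind_eq (x : ZMod 2) : (if x ≠ 0 then 1 else 0) = x := by
  revert x; decide

open Classical in
theorem cut_step [Fintype V] [Fintype E] {l : ℕ} (k : ℕ) (hl : 1 ≤ l) {G : Finset E} (hgap : Gap s t l G)
    {C : Finset E} (hC : C ⊆ G) (hCc : Circ s t C) (hlong : l ≤ C.card) :
    (∃ P : ℕ → Finset E, (∀ j < k, P j ⊆ G ∧ Circ s t (P j) ∧ l ≤ (P j).card) ∧
      ∀ i < k, ∀ j < k, i ≠ j → Disjoint (P i) (P j)) ∨
    ∃ Y ⊆ G, Y.card < k ∧ (∀ D ⊆ G, Circ s t D → D.card < l → par Y D = 0) ∧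
      ∃ z ⊆ G, Ev s t z ∧ par Y z ≠ 0 := by
  set Ls : Finset (Finset E) := C.image (lab s t l G) with hLs
  have hself : ∀ e ∈ G, e ∈ lab s t l G e := fun e he => mem_lab.2 ⟨he, Or.inl rfl⟩
  have hLf : ∀ L ∈ Ls, C ∩ L = C.filter (fun e => lab s t l G e = L) := by
    intro L hL
    obtain ⟨e0, he0, rfl⟩ := mem_image.1 hL
    ext e
    rw [mem_inter, mem_filter]
    constructor
    · rintro ⟨h1, h2⟩
      exact ⟨h1, (lab_eq hgap (mem_lab.1 h2).2).symm⟩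
    · rintro ⟨h1, h2⟩
      exact ⟨h1, h2 ▸ hself e (hC h1)⟩
  have hLdisj : ∀ L ∈ Ls, ∀ x ∈ L, x ∈ G ∧ lab s t l G x = L := by
    intro L hL x hx
    obtain ⟨e0, he0, rfl⟩ := mem_image.1 hL
    exact ⟨(mem_lab.1 hx).1, (lab_eq hgap (mem_lab.1 hx).2).symm⟩
  have hLG : ∀ L ∈ Ls, L ⊆ G := fun L hL x hx => (hLdisj L hL x hx).1
  have hLD : ∀ L ∈ Ls, ∀ L' ∈ Ls, L ≠ L' → Disjoint L L' := by
    intro L hL L' hL' hne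
    rw [Finset.disjoint_left]
    intro x hx hx'
    exact hne ((hLdisj L hL x hx).2.symm.trans (hLdisj L' hL' x hx').2)
  have hLAS : ∀ L ∈ Ls, AllShort s t l L := by
    intro L hL
    obtain ⟨e0, he0, rfl⟩ := mem_image.1 hL
    exact lab_allShort hl hgap e0 (hC he0)
  -- bipartite structure
  obtain ⟨J, a, b, hJne, hJ, hJs⟩ := bip_cycle
    (fun (v : V) (L : Finset E) => L ∈ Ls ∧ bd s t (C ∩ L) v ≠ 0)
    (by
      intro v
      rw [← ZMod.natCast_eq_zero_iff_even]
      refine Eq.trans (b := ((Ls.filter fun L => bd s t (C ∩ L) v ≠ 0).card : ZMod 2)) ?_ ?_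
      · congr 1
        apply congrArg
        ext L; simp
      rw [← sum_boole]
      simp only [ind_eq]
      have h0 : bd s t C v = 0 := congrFun hCc.2.1 v
      rw [← h0, bd_apply,
        ← sum_fiberwise_of_maps_to (s := C) (t := Ls) (g := lab s t l G)
          (fun e he => mem_image_of_mem _ he)]
      apply sum_congr rfl
      intro L hL
      rw [bd_apply, hLf L hL])
    (by
      intro L
      rw [← ZMod.natCast_eq_zero_iff_even]
      by_cases hL : L ∈ Ls
      · simp only [hL, true_and]
        rw [← sum_boole]
        simp only [ind_eq]
        rw [sum_bd]
        simp
      · simp [hL])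
    (by
      obtain ⟨e, he⟩ := hCc.1
      have hL : lab s t l G e ∈ Ls := mem_image_of_mem _ he
      by_contra hcon
      push Not at hcon
      have hev : Ev s t (C ∩ lab s t l G e) := by
        funext v
        exact hcon v _ hL
      have h1 := hCc.2.2 _ inter_subset_left ⟨e, mem_inter.2 ⟨he, hself e (hC he)⟩⟩ hev
      have := hLAS _ hL C (inter_eq_left.1 h1) hCc
      omega)
  have hJL : ∀ L ∈ J, L ∈ Ls := fun L hL => (hJ L hL).2.1.1
  have hQ : ∀ L ∈ J, ∃ q ⊆ L, bd s t q = dl (a L) + dl (b L) := by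
    intro L hL
    obtain ⟨e0, he0, heq⟩ := mem_image.1 (hJL L hL)
    have hr : ∀ w, bd s t (C ∩ L) w ≠ 0 → Rch s t (s e0) L l w := by
      intro w hw
      rw [bd_apply] at hw
      obtain ⟨f, hf, hfw⟩ := exists_ne_zero_of_sum_ne_zero hw
      rw [← heq]
      apply lab_reach hl hgap e0 (hC he0) f (heq ▸ (mem_inter.1 hf).2)
      rcases inc_ne hfw with h | h
      · exact Or.inl h.1
      · exact Or.inr h.2
    obtain ⟨q1, h1, h2, _⟩ := hr _ (hJ L hL).2.1.2
    obtain ⟨q2, h3, h4, _⟩ := hr _ (hJ L hL).2.2.2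
    refine ⟨q1 ∆ q2, symmDiff_subset_union.trans (union_subset h1 h3), ?_⟩
    rw [bd_symmDiff, h2, h4]
    calc _ = (dl (s e0) + dl (s e0)) + (dl (a L) + dl (b L)) := by abel
      _ = _ := by rw [two_zero', zero_add]
  -- unions over J
  have hU : ∀ Q : Finset E → Finset E, (∀ L ∈ J, Q L ⊆ L ∧ bd s t (Q L) = dl (a L) + dl (b L)) →
      (J.biUnion Q ⊆ G ∧ Ev s t (J.biUnion Q) ∧ ∀ (M : Type) [AddCommMonoid M] (w : E → M),
        ∑ e ∈ J.biUnion Q, w e = ∑ L ∈ J, ∑ e ∈ Q L, w e) := by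
    intro Q hQ
    have hd : (J : Set (Finset E)).PairwiseDisjoint Q := by
      intro L hL L' hL' hne
      exact (hLD L (hJL L hL) L' (hJL L' hL') hne).mono (hQ L hL).1 (hQ L' hL').1
    refine ⟨?_, ?_, ?_⟩
    · rw [biUnion_subset]
      intro L hL
      exact (hQ L hL).1.trans (hLG L (hJL L hL))
    · unfold Ev
      rw [← hJs, bd, sum_biUnion hd]
      exact sum_congr rfl fun L hL => (hQ L hL).2
    · intro M _ w
      exact sum_biUnion hd
  -- short circuits versus lumps
  have hDL : ∀ D ⊆ G, Circ s t D → D.card < l → ∀ L ∈ Ls, D ⊆ L ∨ Disjoint D L := by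
    intro D hD hDc hDl L hL
    by_cases h : Disjoint D L
    · exact Or.inr h
    · rw [Finset.not_disjoint_iff] at h
      obtain ⟨x, hx1, hx2⟩ := h
      left
      rw [← (hLdisj L hL x hx2).2]
      exact circ_sub_lab hD hDc hDl hx1
  have hdlab : ∀ L ∈ J, (dl (a L) + dl (b L) : V → ZMod 2) (a L) = 1 := by
    intro L hL
    simp [dl, (hJ L hL).1.symm]
  by_cases hall : ∀ L ∈ J, ∃ P : ℕ → Finset E, (∀ j < k, P j ⊆ L ∧ bd s t (P j) = dl (a L) + dl (b L)) ∧
      ∀ i < k, ∀ j < k, i ≠ j → Disjoint (P i) (P j)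
  · left
    choose! P hP1 hP2 using hall
    have hz : ∀ j < k, ∃ D ⊆ J.biUnion (fun L => P L j), Circ s t D ∧ l ≤ D.card := by
      intro j hj
      obtain ⟨u1, u2, u3⟩ := hU (fun L => P L j) (fun L hL => hP1 L hL j hj)
      by_contra hcon
      push Not at hcon
      obtain ⟨L, hL⟩ := hJne
      have hLs' := hJL L hL
      have key := sum_zero_of_circ (fun e => if e ∈ L then inc s t e else 0) u2 (by
        intro D hD hDc
        have hDl := hcon D hD hDc
        rcases hDL D (hD.trans u1) hDc hDl L hLs' with h | h
        · rw [← hDc.2.1, bd]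
          exact sum_congr rfl fun e he => by simp [h he]
        · exact sum_eq_zero fun e he => by simp [Finset.disjoint_left.1 h he])
      rw [← sum_filter] at key
      have h5 : (J.biUnion (fun L => P L j)).filter (fun e => e ∈ L) = P L j := by
        ext e
        simp only [mem_filter, mem_biUnion]
        constructor
        · rintro ⟨⟨L', hL', he⟩, heL⟩
          by_cases hne : L' = L
          · exact hne ▸ he
          · exact absurd heL (Finset.disjoint_left.1 (hLD L' (hJL L' hL') L hLs' hne)
              ((hP1 L' hL' j hj).1 he))
        · intro he
          exact ⟨⟨L, hL, he⟩, (hP1 L hL j hj).1 he⟩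
      rw [h5] at key
      have h6 := (hP1 L hL j hj).2
      rw [bd, key] at h6
      have h7 := hdlab L hL
      rw [← h6] at h7
      simp at h7
    choose! D hD1 hD2 hD3 using hz
    refine ⟨D, fun j hj => ⟨(hD1 j hj).trans (hU _ (fun L hL => hP1 L hL j hj)).1, hD2 j hj, hD3 j hj⟩, ?_⟩
    intro i hi j hj hij
    refine Disjoint.mono (hD1 i hi) (hD1 j hj) ?_
    rw [disjoint_biUnion_left]
    intro L hL
    rw [disjoint_biUnion_right]
    intro L' hL'
    by_cases hne : L = L'
    · subst hne
      exact hP2 L hL i hi j hj hij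
    · exact (hLD L (hJL L hL) L' (hJL L' hL') hne).mono (hP1 L hL i hi).1 (hP1 L' hL' j hj).1
  · right
    push Not at hall
    obtain ⟨L, hL, hno⟩ := hall
    rcases menger (s := s) (t := t) L (hJ L hL).1 k with ⟨P, hP1, hP2⟩ | ⟨A, haA, hbA, hA⟩
    · obtain ⟨i, hi, j, hj, hij, h⟩ := hno P hP1
      exact absurd (hP2 i hi j hj hij) h
    have hLs' := hJL L hL
    have hcutL : cut s t L A ⊆ L := filter_subset _ _
    have hparL : ∀ F ⊆ L, par (cut s t L A) F = ∑ v ∈ A, bd s t F v := by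
      intro F hF
      rw [sum_bd, par]
      apply sum_congr rfl
      intro e he
      simp [cut, hF he]
    have hpar0 : ∀ F, Disjoint F L → par (cut s t L A) F = 0 := by
      intro F hF
      apply sum_eq_zero
      intro e he
      have : e ∉ cut s t L A := fun h => Finset.disjoint_left.1 hF he (hcutL h)
      simp [this]
    refine ⟨cut s t L A, hcutL.trans (hLG L hLs'), hA, ?_, ?_⟩
    · intro D hD hDc hDl
      rcases hDL D hD hDc hDl L hLs' with h | h
      · rw [hparL D h, hDc.2.1]; simp
      · exact hpar0 D h
    · choose! Q hQ1 hQ2 using hQ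
      obtain ⟨u1, u2, u3⟩ := hU Q (fun L hL => ⟨hQ1 L hL, hQ2 L hL⟩)
      refine ⟨_, u1, u2, ?_⟩
      have : par (cut s t L A) (J.biUnion Q) = ∑ L' ∈ J, par (cut s t L A) (Q L') := u3 _ _
      rw [this, sum_eq_single_of_mem L hL]
      · rw [hparL _ (hQ1 L hL), hQ2 L hL]
        simp [dl, sum_add_distrib, haA, hbA]
      · intro L' hL' hne
        exact hpar0 _ ((hLD L' (hJL L' hL') L hLs' hne).mono_left (hQ1 L' hL'))

end step
end LC
set_option linter.unusedSectionVars false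
set_option linter.unusedVariables false
namespace LC
open Finset
open scoped symmDiff

section count
variable {E V : Type*} [DecidableEq E] [DecidableEq V]

open Classical in
/-- the even subsets of `H` -/
noncomputable def evs (s t : E → V) (H : Finset E) : Finset (Finset E) :=
  H.powerset.filter fun F => Ev s t F

/-- number of even subsets -/
noncomputable def cyc (s t : E → V) (H : Finset E) : ℕ := (evs s t H).card

variable {s t : E → V}

theorem mem_evs {H F : Finset E} : F ∈ evs s t H ↔ F ⊆ H ∧ Ev s t F := by
  simp [evs]

theorem symm_inj (z : Finset E) : Function.Injective (fun F : Finset E => F ∆ z) :=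
  fun a b h => symmDiff_left_injective z h

theorem cyc_mono {H H' : Finset E} (h : H' ⊆ H) : cyc s t H' ≤ cyc s t H :=
  card_le_card fun F hF => mem_evs.2 ⟨(mem_evs.1 hF).1.trans h, (mem_evs.1 hF).2⟩

theorem cyc_erase (H : Finset E) (e : E) : cyc s t H ≤ 2 * cyc s t (H.erase e) := by
  unfold cyc
  by_cases h : ∃ F0 ∈ evs s t H, e ∈ F0
  · obtain ⟨F0, h0, he0⟩ := h
    rw [mem_evs] at h0
    have : evs s t H ⊆ evs s t (H.erase e) ∪ (evs s t (H.erase e)).image (fun F => F ∆ F0) := by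
      intro F hF
      rw [mem_evs] at hF
      rw [mem_union, mem_image]
      by_cases he : e ∈ F
      · right
        refine ⟨F ∆ F0, mem_evs.2 ⟨?_, hF.2.symm h0.2⟩, by simp⟩
        intro x hx
        rw [mem_erase]
        refine ⟨?_, (symmDiff_subset_union.trans (union_subset hF.1 h0.1)) hx⟩
        rintro rfl
        rw [mem_symmDiff] at hx
        tauto
      · left
        rw [mem_evs]
        exact ⟨subset_erase.2 ⟨hF.1, he⟩, hF.2⟩
    have h1 := card_le_card this
    have h2 := card_union_le (evs s t (H.erase e)) ((evs s t (H.erase e)).image (fun F => F ∆ F0))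
    have h3 := card_image_le (s := evs s t (H.erase e)) (f := fun F => F ∆ F0)
    omega
  · push Not at h
    have : evs s t H ⊆ evs s t (H.erase e) := by
      intro F hF
      have := h F hF
      rw [mem_evs] at hF ⊢
      exact ⟨subset_erase.2 ⟨hF.1, this⟩, hF.2⟩
    have := card_le_card this
    omega

theorem cyc_sdiff (H C : Finset E) : cyc s t H ≤ 2 ^ C.card * cyc s t (H \ C) := by
  induction C using Finset.induction_on with
  | empty => simp
  | insert e C he ih =>
    have h1 := cyc_erase (s := s) (t := t) (H \ C) e
    have h2 : H \ insert e C = (H \ C).erase e := by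
      ext x; simp only [mem_sdiff, mem_insert, mem_erase]; tauto
    rw [card_insert_of_notMem he, h2, pow_succ, mul_assoc]
    exact ih.trans (Nat.mul_le_mul_left _ h1)

theorem cyc_double {H H' z : Finset E} (hH : H' ⊆ H) (hz : z ⊆ H) (hev : Ev s t z)
    (hn : ¬ z ⊆ H') : 2 * cyc s t H' ≤ cyc s t H := by
  unfold cyc
  have hd : Disjoint (evs s t H') ((evs s t H').image (fun F => F ∆ z)) := by
    rw [Finset.disjoint_left]
    intro F hF hF'
    obtain ⟨F1, h1, h2⟩ := mem_image.1 hF'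
    rw [mem_evs] at hF h1
    apply hn
    have : z = F1 ∆ F := by rw [← h2]; simp
    rw [this]
    exact symmDiff_subset_union.trans (union_subset h1.1 hF.1)
  have h1 : evs s t H' ∪ (evs s t H').image (fun F => F ∆ z) ⊆ evs s t H := by
    apply union_subset
    · intro F hF
      rw [mem_evs] at *
      exact ⟨hF.1.trans hH, hF.2⟩
    · intro F hF
      obtain ⟨F1, h1, rfl⟩ := mem_image.1 hF
      rw [mem_evs] at *
      exact ⟨symmDiff_subset_union.trans (union_subset (h1.1.trans hH) hz), h1.2.symm hev⟩
  have h2 := card_le_card h1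
  rw [card_union_of_disjoint hd, card_image_of_injective _ (symm_inj z)] at h2
  omega

theorem cyc_rank {H : Finset E} (A : Finset V) (hA : ∀ e ∈ H, s e ∈ A ∧ t e ∈ A) :
    2 ^ H.card ≤ cyc s t H * 2 ^ A.card := by
  have h0 : ∀ F ⊆ H, ∀ v ∉ A, bd s t F v = 0 := by
    intro F hF v hv
    rw [bd_apply]
    apply sum_eq_zero
    intro e he
    have := hA e (hF he)
    have h1 : s e ≠ v := fun h => hv (h ▸ this.1)
    have h2 : t e ≠ v := fun h => hv (h ▸ this.2)
    simp [inc, dl, h1, h2]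
  have h1 := card_le_mul_card_image (f := fun F => A.filter fun v => bd s t F v ≠ 0) H.powerset
    (cyc s t H) (by
      intro b hb
      obtain ⟨F0, hF0, rfl⟩ := mem_image.1 hb
      rw [mem_powerset] at hF0
      unfold cyc
      rw [← card_image_of_injective (H.powerset.filter _) (symm_inj F0)]
      apply card_le_card
      intro X hX
      obtain ⟨F, hF, rfl⟩ := mem_image.1 hX
      rw [mem_filter, mem_powerset] at hF
      rw [mem_evs]
      refine ⟨symmDiff_subset_union.trans (union_subset hF.1 hF0), ?_⟩
      have : bd s t F = bd s t F0 := by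
        funext v
        by_cases hv : v ∈ A
        · have h3 : v ∈ (A.filter fun v => bd s t F v ≠ 0) ↔ v ∈ (A.filter fun v => bd s t F0 v ≠ 0) := by
            rw [hF.2]
          simp only [mem_filter, hv, true_and] at h3
          by_cases h4 : bd s t F v = 0
          · rw [h4]
            by_contra h5
            exact h3.2 (Ne.symm h5) h4
          · rw [zmod2_ne h4, zmod2_ne (h3.1 h4)]
        · rw [h0 F hF.1 v hv, h0 F0 hF0 v hv]
      unfold Ev
      rw [bd_symmDiff, this, two_zero'])
  rw [card_powerset] at h1
  refine h1.trans (Nat.mul_le_mul_left _ ?_)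
  rw [← card_powerset]
  apply card_le_card
  intro X hX
  obtain ⟨F, hF, rfl⟩ := mem_image.1 hX
  rw [mem_powerset]
  exact filter_subset _ _

theorem moore {H : Finset E} {A : Finset V} (hA : ∀ e ∈ H, s e ∈ A ∧ t e ∈ A)
    (hloop : ∀ e ∈ H, s e ≠ t e) (hne : A.Nonempty)
    (hdeg : ∀ v ∈ A, 3 ≤ (H.filter fun e => s e = v ∨ t e = v).card) :
    ∃ F ⊆ H, F.Nonempty ∧ Ev s t F ∧ F.card ≤ 2 * Nat.log 2 A.card + 2 := by
  by_contra hcon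
  push Not at hcon
  obtain ⟨r, hr⟩ := hne
  set R := Nat.log 2 A.card with hR
  have key : ∀ n ≤ R + 1, ∃ (S : Finset V) (T : Finset E), S ⊆ A ∧ T ⊆ H ∧ T.card + 1 = S.card ∧
      (∀ e ∈ T, s e ∈ S ∧ t e ∈ S) ∧ (∀ w ∈ S, Rch s t r T n w) ∧ 2 ^ n ≤ S.card := by
    intro n
    induction n with
    | zero =>
      intro _
      refine ⟨{r}, ∅, by simpa using hr, by simp, by simp, by simp, ?_, by simp⟩
      intro w hw
      rw [mem_singleton] at hw
      subst hw
      exact ⟨∅, by simp, by rw [bd_empty, two_zero'], by simp⟩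
    | succ n ih =>
      intro hn
      obtain ⟨S, T, hS, hT, hc, hTe, hq, hpow⟩ := ih (by omega)
      choose! q hq1 hq2 hq3 using hq
      have hqc : ∀ x ∈ S, ∀ y ∈ S, (q x ∆ q y).card ≤ 2 * n := by
        intro x hx y hy
        have h1 := card_le_card (symmDiff_subset_union : q x ∆ q y ⊆ q x ∪ q y)
        have h2 := card_union_le (q x) (q y)
        have := hq3 x hx
        have := hq3 y hy
        omega
      have hqb : ∀ x ∈ S, ∀ y ∈ S, bd s t (q x ∆ q y) = dl x + dl y := by
        intro x hx y hy
        rw [bd_symmDiff, hq2 x hx, hq2 y hy]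
        calc _ = (dl r + dl r) + (dl x + dl y) := by abel
          _ = _ := by rw [two_zero', zero_add]
      have hqT : ∀ x ∈ S, ∀ y ∈ S, q x ∆ q y ⊆ T := fun x hx y hy =>
        symmDiff_subset_union.trans (union_subset (hq1 x hx) (hq1 y hy))
      set N := (H \ T).filter (fun e => s e ∈ S ∨ t e ∈ S) with hN
      have hN' : ∀ e, e ∈ N ↔ (e ∈ H ∧ e ∉ T) ∧ (s e ∈ S ∨ t e ∈ S) := by
        intro e; simp [hN]
      -- not both ends in S
      have hboth : ∀ e ∈ N, ¬ (s e ∈ S ∧ t e ∈ S) := by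
        rintro e he ⟨h1, h2⟩
        rw [hN'] at he
        have hnot : e ∉ q (s e) ∆ q (t e) := fun h => he.1.2 (hqT _ h1 _ h2 h)
        have := hcon (insert e (q (s e) ∆ q (t e)))
          (insert_subset he.1.1 ((hqT _ h1 _ h2).trans hT)) ⟨e, mem_insert_self _ _⟩ (by
            unfold Ev
            rw [bd_insert hnot, hqb _ h1 _ h2, inc, two_zero'])
        rw [card_insert_of_notMem hnot] at this
        have := hqc _ h1 _ h2
        omega
      let out : E → V := fun e => if s e ∈ S then t e else s e
      let inn : E → V := fun e => if s e ∈ S then s e else t e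
      have hout : ∀ e ∈ N, out e ∉ S ∧ inn e ∈ S ∧ inc s t e = dl (inn e) + dl (out e) ∧ out e ∈ A := by
        intro e he
        have h1 := hboth e he
        rw [hN'] at he
        have h2 := hA e he.1.1
        simp only [out, inn]
        by_cases h : s e ∈ S
        · simp only [h, if_true, inc]
          tauto
        · simp only [h, if_false, inc]
          exact ⟨not_false, he.2.resolve_left h, add_comm _ _, h2.1⟩
      have hinj : Set.InjOn out N := by
        intro e he f hf hef
        by_contra hne
        rw [mem_coe] at he hf
        obtain ⟨o1, o2, o3, _⟩ := hout e he
        obtain ⟨p1, p2, p3, _⟩ := hout f hf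
        rw [hN'] at he hf
        have hnf : f ∉ q (inn e) ∆ q (inn f) := fun h => hf.1.2 (hqT _ o2 _ p2 h)
        have hne' : e ∉ insert f (q (inn e) ∆ q (inn f)) := by
          rw [mem_insert]
          rintro (h | h)
          · exact hne h
          · exact he.1.2 (hqT _ o2 _ p2 h)
        have := hcon (insert e (insert f (q (inn e) ∆ q (inn f))))
          (insert_subset he.1.1 (insert_subset hf.1.1 ((hqT _ o2 _ p2).trans hT)))
          ⟨e, mem_insert_self _ _⟩ (by
            unfold Ev
            rw [bd_insert hne', bd_insert hnf, hqb _ o2 _ p2, o3, p3, hef]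
            calc _ = (dl (inn e) + dl (inn e)) + (dl (inn f) + dl (inn f))
                  + (dl (out f) + dl (out f)) := by abel
              _ = _ := by simp only [two_zero', add_zero])
        rw [card_insert_of_notMem hne', card_insert_of_notMem hnf] at this
        have := hqc _ o2 _ p2
        omega
      -- counting
      have hcount : 3 * S.card ≤ 2 * T.card + N.card := by
        have h1 : 3 * S.card ≤ ∑ v ∈ S, (H.filter fun e => s e = v ∨ t e = v).card := by
          rw [mul_comm, ← smul_eq_mul]
          exact card_nsmul_le_sum _ _ _ fun v hv => hdeg v (hS hv)
        have h2 : ∑ v ∈ S, (H.filter fun e => s e = v ∨ t e = v).card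
            = ∑ e ∈ H, (S.filter fun v => s e = v ∨ t e = v).card := by
          simp only [card_filter]
          exact sum_comm
        have h3 : ∀ e ∈ H, (S.filter fun v => s e = v ∨ t e = v).card
            ≤ (if e ∈ T then 2 else 0) + (if e ∈ N then 1 else 0) := by
          intro e he
          by_cases heT : e ∈ T
          · have : (S.filter fun v => s e = v ∨ t e = v) ⊆ {s e, t e} := by
              intro v hv
              simp only [mem_filter] at hv
              simp only [mem_insert, mem_singleton]
              tauto
            have h4 := (card_le_card this).trans card_le_two
            simp only [heT, if_true]
            omega
          · by_cases heN : e ∈ N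
            · have : (S.filter fun v => s e = v ∨ t e = v) ⊆ {inn e} := by
                intro v hv
                have hb := hboth e heN
                simp only [mem_filter] at hv
                simp only [mem_singleton, inn]
                by_cases h : s e ∈ S
                · simp only [h, if_true]
                  rcases hv.2 with h5 | h5
                  · exact h5.symm
                  · exact absurd ⟨h, h5 ▸ hv.1⟩ hb
                · simp only [h, if_false]
                  rcases hv.2 with h5 | h5
                  · exact absurd (h5 ▸ hv.1) h
                  · exact h5.symm
              have h4 := card_le_card this
              simpa [heT, heN] using h4
            · have : (S.filter fun v => s e = v ∨ t e = v) = ∅ := by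
                rw [filter_eq_empty_iff]
                intro v hv h
                apply heN
                rw [hN']
                refine ⟨⟨he, heT⟩, ?_⟩
                rcases h with h | h
                · exact Or.inl (h ▸ hv)
                · exact Or.inr (h ▸ hv)
              rw [this]; simp
        have h4 := sum_le_sum h3
        have hNH : N ⊆ H := (filter_subset _ _).trans sdiff_subset
        rw [sum_add_distrib, ← sum_filter, ← sum_filter, filter_mem_eq_inter, filter_mem_eq_inter,
          inter_eq_right.2 hT, inter_eq_right.2 hNH] at h4
        simp only [sum_const, smul_eq_mul] at h4
        omega
      have hdS : Disjoint S (N.image out) := by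
        rw [Finset.disjoint_right]
        intro v hv
        obtain ⟨e, he, rfl⟩ := mem_image.1 hv
        exact (hout e he).1
      have hdT : Disjoint T N := by
        rw [Finset.disjoint_right]
        intro e he
        exact ((hN' e).1 he).1.2
      refine ⟨S ∪ N.image out, T ∪ N, ?_, ?_, ?_, ?_, ?_, ?_⟩
      · apply union_subset hS
        intro v hv
        obtain ⟨e, he, rfl⟩ := mem_image.1 hv
        exact (hout e he).2.2.2
      · exact union_subset hT ((filter_subset _ _).trans sdiff_subset)
      · rw [card_union_of_disjoint hdS, card_union_of_disjoint hdT, card_image_of_injOn hinj]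
        omega
      · intro e he
        rcases mem_union.1 he with h | h
        · exact ⟨mem_union_left _ (hTe e h).1, mem_union_left _ (hTe e h).2⟩
        · have ho : out e ∈ N.image out := mem_image_of_mem _ h
          have hi := (hout e h).2.1
          simp only [out, inn] at ho hi
          by_cases hs : s e ∈ S
          · simp only [hs, if_true] at ho
            exact ⟨mem_union_left _ hs, mem_union_right _ ho⟩
          · simp only [hs, if_false] at ho hi
            exact ⟨mem_union_right _ ho, mem_union_left _ hi⟩
      · intro w hw
        rcases mem_union.1 hw with h | h
        · exact Rch.mono ⟨q w, hq1 w h, hq2 w h, hq3 w h⟩ subset_union_left (by omega)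
        · obtain ⟨e, he, rfl⟩ := mem_image.1 h
          obtain ⟨o1, o2, o3, _⟩ := hout e he
          have hnot : e ∉ q (inn e) := fun h => ((hN' e).1 he).1.2 (hq1 _ o2 h)
          refine ⟨insert e (q (inn e)), insert_subset (mem_union_right _ he)
            ((hq1 _ o2).trans subset_union_left), ?_, ?_⟩
          · rw [bd_insert hnot, hq2 _ o2, o3]
            calc _ = (dl (inn e) + dl (inn e)) + (dl r + dl (out e)) := by abel
              _ = _ := by rw [two_zero', zero_add]
          · rw [card_insert_of_notMem hnot]
            have := hq3 _ o2
            omega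
      · rw [card_union_of_disjoint hdS, card_image_of_injOn hinj, pow_succ]
        omega
  obtain ⟨S, T, hS, _, _, _, _, hpow⟩ := key (R + 1) le_rfl
  have h1 := card_le_card hS
  have h2 := Nat.lt_pow_succ_log_self (b := 2) (by norm_num) A.card
  rw [← hR, Nat.succ_eq_add_one] at h2
  omega

end count
end LC
set_option linter.unusedSectionVars false
set_option linter.unusedVariables false
namespace LC
open Finset
open scoped symmDiff

section packing
variable {E V : Type*} [DecidableEq E] [DecidableEq V]

/-- `k` disjoint nonempty even subsets -/
def PackEv (s t : E → V) (k : ℕ) (H : Finset E) : Prop :=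
  ∃ P : ℕ → Finset E, (∀ j < k, P j ⊆ H ∧ (P j).Nonempty ∧ Ev s t (P j)) ∧
    ∀ i < k, ∀ j < k, i ≠ j → Disjoint (P i) (P j)

/-- the bound on the cyclomatic number -/
def phi (k : ℕ) : ℕ := 64 * (k * (Nat.log 2 k + 1))

theorem phi_pos (k : ℕ) : 1 ≤ phi (k + 1) := by
  unfold phi
  have : 0 < (k + 1) * (Nat.log 2 (k + 1) + 1) := by positivity
  omega

theorem phi_step (k : ℕ) : phi k + (2 * Nat.log 2 (2 * phi (k + 1)) + 2) ≤ phi (k + 1) := by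
  set L := Nat.log 2 (k + 1) with hL
  have h1 : phi k + 64 * (L + 1) ≤ phi (k + 1) := by
    unfold phi
    rw [← hL]
    have h2 : Nat.log 2 k ≤ L := Nat.log_mono_right (by omega)
    have h3 : k * (Nat.log 2 k + 1) ≤ k * (L + 1) := Nat.mul_le_mul_left _ (by omega)
    have h4 : (k + 1) * (L + 1) = k * (L + 1) + (L + 1) := by ring
    omega
  have h2 : k + 1 < 2 ^ (L + 1) := Nat.lt_pow_succ_log_self (by norm_num) _
  have h3 : L + 1 < 2 ^ (L + 1) := Nat.lt_two_pow_self
  have h4 : 2 * phi (k + 1) < 2 ^ (2 * L + 9) := by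
    unfold phi
    rw [← hL]
    have : (k + 1) * (L + 1) < 2 ^ (L + 1) * 2 ^ (L + 1) := Nat.mul_lt_mul_of_lt_of_le h2 h3.le (by positivity)
    have h5 : 2 ^ (2 * L + 9) = 128 * (2 ^ (L + 1) * 2 ^ (L + 1)) := by ring
    omega
  have h5 : Nat.log 2 (2 * phi (k + 1)) < 2 * L + 9 := Nat.log_lt_of_lt_pow (by have := phi_pos k; omega) h4
  omega

theorem PackEv.mono {s t : E → V} {k : ℕ} {H H' : Finset E} (h : PackEv s t k H') (hH : H' ⊆ H) :
    PackEv s t k H := by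
  obtain ⟨P, h1, h2⟩ := h
  exact ⟨P, fun j hj => ⟨(h1 j hj).1.trans hH, (h1 j hj).2⟩, h2⟩

theorem PackEv.peel {s t : E → V} {k : ℕ} {H C : Finset E} (hC : C ⊆ H) (hne : C.Nonempty)
    (hev : Ev s t C) (h : PackEv s t k (H \ C)) : PackEv s t (k + 1) H := by
  obtain ⟨P, h1, h2⟩ := h
  have hd : ∀ j < k, Disjoint C (P j) := fun j hj =>
    disjoint_sdiff.mono_right (h1 j hj).1
  refine ⟨fun j => if j < k then P j else C, ?_, ?_⟩
  · intro j hj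
    dsimp only
    split_ifs with h
    · exact ⟨(h1 j h).1.trans sdiff_subset, (h1 j h).2⟩
    · exact ⟨hC, hne, hev⟩
  · intro i hi j hj hij
    dsimp only
    split_ifs with h h' h'
    · exact h2 i h j h' hij
    · exact (hd i h).symm
    · exact hd j h'
    · omega

/-- contraction of an edge at a vertex of degree two -/
theorem contract {s t : E → V} {H : Finset E} {e f : E} {u v : V} (k : ℕ)
    (he : e ∈ H) (hf : f ∈ H) (hef : e ≠ f) (huv : u ≠ v)
    (hinc : inc s t e = dl u + dl v) (hends : (s e = u ∧ t e = v) ∨ (s e = v ∧ t e = u))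
    (hfv : inc s t f v = 1)
    (hother : ∀ g ∈ H, g ≠ e → g ≠ f → s g ≠ v ∧ t g ≠ v)
    (ih : ∀ s' t' : E → V, cyc s t H ≤ cyc s' t' (H.erase e) → PackEv s' t' k (H.erase e)) :
    PackEv s t k H := by
  let π : V → V := fun x => if x = v then u else x
  let s' : E → V := fun g => π (s g)
  let t' : E → V := fun g => π (t g)
  have hdl : ∀ a x, dl (π a) x = if x = v then 0 else if x = u then dl a u + dl a v else dl a x := by
    intro a x
    simp only [dl, π]
    grind
  have hinc' : ∀ g x, inc s' t' g x =
      if x = v then 0 else if x = u then inc s t g u + inc s t g v else inc s t g x := by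
    intro g x
    simp only [inc, Pi.add_apply, s', t', hdl]
    split_ifs
    · rw [add_zero]
    · abel
    · rfl
  have hbd' : ∀ F x, bd s' t' F x =
      if x = v then 0 else if x = u then bd s t F u + bd s t F v else bd s t F x := by
    intro F x
    simp only [bd_apply, hinc']
    split_ifs
    · simp
    · rw [sum_add_distrib]
    · rfl
  have hes : inc s' t' e = 0 := by
    have h1 : s' e = u := by
      simp only [s', π]; grind
    have h2 : t' e = u := by
      simp only [t', π]; grind
    rw [inc, h1, h2, two_zero']
  have hev : ∀ g, g ≠ e → g ≠ f → g ∈ H → inc s t g v = 0 := by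
    intro g h1 h2 h3
    have := hother g h3 h1 h2
    simp [inc, dl, this.1, this.2]
  have hee : inc s t e v = 1 := by
    rw [hinc]; simp [dl, huv]
  have hbv : ∀ F ⊆ H, bd s t F v = (if e ∈ F then 1 else 0) + (if f ∈ F then 1 else 0) := by
    intro F hF
    rw [bd_apply]
    have h1 : ∀ g ∈ F, inc s t g v = (if g = e then 1 else 0) + (if g = f then 1 else 0) := by
      intro g hg
      by_cases h1 : g = e
      · subst h1; simp [hee, hef]
      · by_cases h2 : g = f
        · subst h2; simp [hfv, h1]
        · simp [hev g h1 h2 (hF hg), h1, h2]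
    rw [sum_congr rfl h1, sum_add_distrib]
    simp
  have hiff : ∀ F ⊆ H, Ev s t F → (e ∈ F ↔ f ∈ F) := by
    intro F hF hFe
    have h1 := hbv F hF
    rw [hFe] at h1
    by_cases h2 : e ∈ F <;> by_cases h3 : f ∈ F <;> simp [h2, h3] at h1 ⊢
  obtain ⟨P, hP1, hP2⟩ := ih s' t' (by
    unfold cyc
    have hinj : Set.InjOn (fun F : Finset E => F.erase e) (evs s t H) := by
      intro F hF F' hF' hFF
      rw [mem_coe, mem_evs] at hF hF'
      have h1 := hiff F hF.1 hF.2
      have h2 := hiff F' hF'.1 hF'.2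
      have h3 : ∀ x, x ∈ F.erase e ↔ x ∈ F'.erase e := fun x => by
        have : F.erase e = F'.erase e := hFF
        rw [this]
      ext x
      by_cases hx : x = e
      · subst hx
        have := h3 f
        simp only [mem_erase, hef.symm, ne_eq, not_false_eq_true, true_and] at this
        tauto
      · have := h3 x
        simpa only [mem_erase, hx, ne_eq, not_false_eq_true, true_and] using this
    rw [← card_image_of_injOn hinj]
    apply card_le_card
    intro X hX
    obtain ⟨F, hF, rfl⟩ := mem_image.1 hX
    rw [mem_evs] at hF ⊢
    refine ⟨erase_subset_erase _ hF.1, ?_⟩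
    have h1 : bd s' t' (F.erase e) = bd s' t' F := by
      by_cases h : e ∈ F
      · have := bd_insert (s := s') (t := t') (notMem_erase e F)
        rw [insert_erase h, hes, zero_add] at this
        exact this.symm
      · rw [erase_eq_of_notMem h]
    unfold Ev
    rw [h1]
    funext x
    rw [hbd', hF.2]
    simp)
  have heP : ∀ j < k, e ∉ P j := fun j hj h => by
    have := (hP1 j hj).1 h
    simp at this
  refine ⟨fun j => if f ∈ P j then insert e (P j) else P j, ?_, ?_⟩
  · intro j hj
    obtain ⟨p1, p2, p3⟩ := hP1 j hj
    have p1' : P j ⊆ H := p1.trans (erase_subset _ _)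
    have lift : ∀ D ⊆ H, bd s' t' D = 0 → (e ∈ D ↔ f ∈ D) → Ev s t D := by
      intro D hD hD0 hi
      have h1 : bd s t D v = 0 := by
        rw [hbv D hD]
        by_cases h : f ∈ D
        · simp [hi.2 h, h, two_zero]
        · have : e ∉ D := fun h' => h (hi.1 h')
          simp [this, h]
      funext x
      have h2 := hbd' D x
      rw [hD0] at h2
      by_cases hx : x = v
      · rw [hx, h1]; rfl
      · by_cases hxu : x = u
        · subst hxu
          simp only [huv, if_false, if_true, h1, add_zero] at h2
          exact h2.symm
        · simp only [hx, hxu, if_false] at h2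
          exact h2.symm
    dsimp only
    split_ifs with h
    · refine ⟨insert_subset he p1', ⟨e, mem_insert_self _ _⟩, lift _ (insert_subset he p1') ?_ (by simp [h])⟩
      rw [bd_insert (heP j hj), hes, zero_add, p3]
    · exact ⟨p1', p2, lift _ p1' p3 (by simp [h, heP j hj])⟩
  · intro i hi j hj hij
    have hd := hP2 i hi j hj hij
    have h1 := heP i hi
    have h2 := heP j hj
    dsimp only
    split_ifs with h h' h'
    · exact absurd h' (Finset.disjoint_left.1 hd h)
    · rw [disjoint_insert_left]; exact ⟨h2, hd⟩
    · rw [disjoint_insert_right]; exact ⟨h1, hd⟩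
    · exact hd

set_option maxHeartbeats 400000 in
theorem pack (k : ℕ) : ∀ (s t : E → V) (H : Finset E), 2 ^ phi k ≤ cyc s t H → PackEv s t k H := by
  induction k with
  | zero => intro s t H _; exact ⟨fun _ => ∅, by simp, by simp⟩
  | succ k ihk =>
    suffices ∀ (n : ℕ) (s t : E → V) (H : Finset E), H.card = n → 2 ^ phi (k + 1) ≤ cyc s t H →
        PackEv s t (k + 1) H from fun s t H h => this _ s t H rfl h
    intro n
    induction n using Nat.strong_induction_on with
    | _ n ih =>
      intro s t H hn hz
      have hstep := phi_step k
      have hpos := phi_pos k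
      by_cases hdel : ∃ e ∈ H, 2 ^ phi (k + 1) ≤ cyc s t (H.erase e)
      · obtain ⟨e, he, h⟩ := hdel
        exact (ih _ (by rw [← hn]; exact card_erase_lt_of_mem he) s t (H.erase e) rfl h).mono
          (erase_subset _ _)
      push Not at hdel
      have hHne : H.Nonempty := by
        by_contra h
        rw [not_nonempty_iff_eq_empty] at h
        subst h
        have : cyc s t ∅ ≤ 1 := by
          have h3 : evs s t ∅ ⊆ {∅} := fun F hF => by
            have := (mem_evs.1 hF).1
            simpa using this
          exact (card_le_card h3).trans (by simp)
        have h2 : 2 ^ 1 ≤ 2 ^ phi (k + 1) := Nat.pow_le_pow_right (by norm_num) hpos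
        omega
      have hub : cyc s t H < 2 ^ (phi (k + 1) + 1) := by
        obtain ⟨e, he⟩ := hHne
        have h1 := hdel e he
        have h2 := cyc_erase (s := s) (t := t) H e
        rw [pow_succ]; omega
      have hin : ∀ e ∈ H, ∃ F ⊆ H, Ev s t F ∧ e ∈ F := by
        intro e he
        by_contra hcon
        push Not at hcon
        have : evs s t H ⊆ evs s t (H.erase e) := by
          intro F hF
          rw [mem_evs] at *
          exact ⟨subset_erase.2 ⟨hF.1, hcon F hF.1 hF.2⟩, hF.2⟩
        have h1 := card_le_card this
        have h2 := hdel e he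
        unfold cyc at *
        omega
      have hpeel : ∀ C ⊆ H, C.Nonempty → Ev s t C → phi k + C.card ≤ phi (k + 1) →
          PackEv s t (k + 1) H := by
        intro C hC hne hev hc
        refine PackEv.peel hC hne hev (ihk s t _ ?_)
        have h1 := hz.trans (cyc_sdiff H C)
        have h2 : 2 ^ (C.card + phi k) ≤ 2 ^ phi (k + 1) := Nat.pow_le_pow_right (by norm_num) (by omega)
        rw [pow_add] at h2
        exact Nat.le_of_mul_le_mul_left (h2.trans h1) (by positivity)
      by_cases hloop : ∃ e ∈ H, s e = t e
      · obtain ⟨e, he, hst⟩ := hloop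
        refine hpeel {e} (by simpa using he) (by simp) ?_ (by simp; omega)
        unfold Ev bd
        rw [sum_singleton, inc, hst, two_zero']
      push Not at hloop
      set A := H.image s ∪ H.image t with hA
      have hAe : ∀ e ∈ H, s e ∈ A ∧ t e ∈ A := fun e he =>
        ⟨mem_union_left _ (mem_image_of_mem _ he), mem_union_right _ (mem_image_of_mem _ he)⟩
      by_cases hdeg : ∀ v ∈ A, 3 ≤ (H.filter fun e => s e = v ∨ t e = v).card
      · have hAne : A.Nonempty := by
          obtain ⟨e, he⟩ := hHne
          exact ⟨_, (hAe e he).1⟩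
        obtain ⟨C, hC, hCne, hCe, hCc⟩ := moore hAe hloop hAne hdeg
        refine hpeel C hC hCne hCe ?_
        have h1 : 3 * A.card ≤ 2 * H.card := by
          have h1 : 3 * A.card ≤ ∑ v ∈ A, (H.filter fun e => s e = v ∨ t e = v).card := by
            rw [mul_comm, ← smul_eq_mul]
            exact card_nsmul_le_sum _ _ _ fun v hv => hdeg v hv
          have h2 : ∑ v ∈ A, (H.filter fun e => s e = v ∨ t e = v).card
              = ∑ e ∈ H, (A.filter fun v => s e = v ∨ t e = v).card := by
            simp only [card_filter]
            exact sum_comm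
          have h3 : ∑ e ∈ H, (A.filter fun v => s e = v ∨ t e = v).card ≤ H.card • 2 := by
            apply sum_le_card_nsmul
            intro e he
            have : (A.filter fun v => s e = v ∨ t e = v) ⊆ {s e, t e} := by
              intro v hv
              simp only [mem_filter] at hv
              simp only [mem_insert, mem_singleton]
              exact hv.2.imp Eq.symm Eq.symm
            exact (card_le_card this).trans card_le_two
          rw [smul_eq_mul] at h3
          omega
        have h2 : H.card < phi (k + 1) + 1 + A.card := by
          have h3 := cyc_rank A hAe
          have h4 : 2 ^ H.card < 2 ^ (phi (k + 1) + 1 + A.card) := by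
            rw [pow_add 2 (phi (k + 1) + 1) A.card]
            exact lt_of_le_of_lt h3 (Nat.mul_lt_mul_of_pos_right hub (Nat.two_pow_pos _))
          exact (Nat.pow_lt_pow_iff_right Nat.one_lt_two).1 h4
        have h3 : Nat.log 2 A.card ≤ Nat.log 2 (2 * phi (k + 1)) := Nat.log_mono_right (by omega)
        omega
      push Not at hdeg
      obtain ⟨v, hv, hdv⟩ := hdeg
      obtain ⟨e, he, hev⟩ : ∃ e ∈ H, s e = v ∨ t e = v := by
        rcases mem_union.1 hv with h | h
        · obtain ⟨e, he, h⟩ := mem_image.1 h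
          exact ⟨e, he, Or.inl h⟩
        · obtain ⟨e, he, h⟩ := mem_image.1 h
          exact ⟨e, he, Or.inr h⟩
      have hinc1 : ∀ g ∈ H, (s g = v ∨ t g = v) → inc s t g v = 1 := by
        intro g hg h
        have := hloop g hg
        rcases h with rfl | rfl
        · simp [inc, dl, this.symm]
        · simp [inc, dl, this]
      obtain ⟨F, hF, hFe, heF⟩ := hin e he
      obtain ⟨f, hfF, hfe, hfv⟩ : ∃ f ∈ F, f ≠ e ∧ inc s t f v ≠ 0 := by
        by_contra hcon
        push Not at hcon
        have h1 : bd s t F v = 0 := congrFun hFe v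
        rw [bd_apply, sum_eq_single_of_mem e heF (fun g hg hne => hcon g hg hne), hinc1 e he hev] at h1
        exact one_ne_zero h1
      have hf : f ∈ H := hF hfF
      have hfv' : s f = v ∨ t f = v := by
        rcases inc_ne hfv with h | h
        · exact Or.inl h.1
        · exact Or.inr h.2
      have hother : ∀ g ∈ H, g ≠ e → g ≠ f → s g ≠ v ∧ t g ≠ v := by
        intro g hg h1 h2
        by_contra hcon
        have hgv : s g = v ∨ t g = v := by
          rw [not_and_or, not_not, not_not] at hcon; exact hcon
        have : ({e, f, g} : Finset E) ⊆ H.filter fun e => s e = v ∨ t e = v := by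
          intro x hx
          simp only [mem_insert, mem_singleton] at hx
          rw [mem_filter]
          rcases hx with rfl | rfl | rfl
          · exact ⟨he, hev⟩
          · exact ⟨hf, hfv'⟩
          · exact ⟨hg, hgv⟩
        have h3 := card_le_card this
        rw [card_eq_three.2 ⟨e, f, g, hfe.symm, h1.symm, h2.symm, rfl⟩] at h3
        omega
      have hlt : (H.erase e).card < n := by rw [← hn]; exact card_erase_lt_of_mem he
      have ih' : ∀ s' t' : E → V, cyc s t H ≤ cyc s' t' (H.erase e) → PackEv s' t' (k + 1) (H.erase e) :=
        fun s' t' h => ih _ hlt s' t' _ rfl (hz.trans h)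
      have hl := hloop e he
      rcases hev with h | h
      · exact contract (u := t e) (v := v) (k + 1) he hf hfe.symm (fun h' => hl (h.trans h'.symm))
          (by rw [inc, h, add_comm]) (Or.inr ⟨h, rfl⟩) (hinc1 f hf hfv') hother ih'
      · exact contract (u := s e) (v := v) (k + 1) he hf hfe.symm (fun h' => hl (h'.trans h.symm))
          (by rw [inc, h]) (Or.inl ⟨rfl, h⟩) (hinc1 f hf hfv') hother ih'

end packing
end LC
set_option linter.unusedSectionVars false
set_option linter.unusedVariables false
namespace LC
open Finset
open scoped symmDiff

section main
variable {E V : Type*} [DecidableEq E] [DecidableEq V]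

/-- `k` disjoint long circuits -/
def PackLong (s t : E → V) (l k : ℕ) (G : Finset E) : Prop :=
  ∃ P : ℕ → Finset E, (∀ j < k, P j ⊆ G ∧ Circ s t (P j) ∧ l ≤ (P j).card) ∧
      ∀ i < k, ∀ j < k, i ≠ j → Disjoint (P i) (P j)

/-- all circuits are long -/
def NoShort (s t : E → V) (l : ℕ) (H : Finset E) : Prop :=
  ∀ C ⊆ H, Circ s t C → l ≤ C.card

variable {s t : E → V}

theorem PackLong.mono {l k : ℕ} {G G' : Finset E} (h : PackLong s t l k G') (hG : G' ⊆ G) :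
    PackLong s t l k G := by
  obtain ⟨P, h1, h2⟩ := h
  exact ⟨P, fun j hj => ⟨(h1 j hj).1.trans hG, (h1 j hj).2⟩, h2⟩

theorem PackLong.peel {l k : ℕ} {G C : Finset E} (hC : C ⊆ G) (hCc : Circ s t C) (hl : l ≤ C.card)
    (h : PackLong s t l k (G \ C)) : PackLong s t l (k + 1) G := by
  obtain ⟨P, h1, h2⟩ := h
  have hd : ∀ j < k, Disjoint C (P j) := fun j hj =>
    disjoint_sdiff.mono_right (h1 j hj).1
  refine ⟨fun j => if j < k then P j else C, ?_, ?_⟩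
  · intro j hj
    dsimp only
    split_ifs with h
    · exact ⟨(h1 j h).1.trans sdiff_subset, (h1 j h).2⟩
    · exact ⟨hC, hCc, hl⟩
  · intro i hi j hj hij
    dsimp only
    split_ifs with h h' h'
    · exact h2 i h j h' hij
    · exact (hd i h).symm
    · exact hd j h'
    · omega

theorem par_symm (Y A B : Finset E) : par Y (A ∆ B) = par Y A + par Y B :=
  sum_symmDiff two_zero _ A B

theorem iter [Fintype V] [Fintype E] {l k : ℕ} (hl : 1 ≤ l) (hk : 1 ≤ k) (n : ℕ) :
    ∀ G : Finset E, Gap s t l G → ¬ PackLong s t l k G →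
      (∀ H ⊆ G, NoShort s t l H → cyc s t H < 2 ^ (n + 1)) →
      ∃ X : Finset E, X.card ≤ (k - 1) * n ∧ AllShort s t l (G \ X) := by
  classical
  induction n with
  | zero =>
    intro G hgap hno hcyc
    refine ⟨∅, by simp, ?_⟩
    rw [sdiff_empty]
    intro C hC hCc
    by_contra hlong
    push Not at hlong
    have h1 := hcyc C hC (fun D hD hDc => by rw [hCc.eq_of_subset hDc hD]; exact hlong)
    have h2 := cyc_double (s := s) (t := t) (empty_subset C) (subset_refl C) hCc.2.1 (by
      intro h
      exact hCc.1.ne_empty (subset_empty.1 h))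
    have h3 : 0 < cyc s t ∅ := card_pos.2 ⟨∅, mem_evs.2 ⟨subset_rfl, ev_empty⟩⟩
    norm_num at h1
    omega
  | succ n ih =>
    intro G hgap hno hcyc
    by_cases hAS : AllShort s t l G
    · exact ⟨∅, by simp, by simpa using hAS⟩
    unfold AllShort at hAS
    push Not at hAS
    obtain ⟨C, hC, hCc, hlong⟩ := hAS
    rcases cut_step k hl hgap hC hCc hlong with h | ⟨Y, hYG, hYk, hYs, z, hzG, hze, hzp⟩
    · exact absurd h hno
    obtain ⟨X, hX, hXs⟩ := ih (G \ Y) (hgap.mono sdiff_subset)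
      (fun h => hno (h.mono sdiff_subset)) (by
        intro H' hH' hns
        have hH'G : H' ⊆ G := hH'.trans sdiff_subset
        obtain ⟨H, hH, hmax⟩ := exists_max_image
          (G.powerset.filter fun H => H' ⊆ H ∧ NoShort s t l H) Finset.card
          ⟨H', by rw [mem_filter, mem_powerset]; exact ⟨hH'G, subset_rfl, hns⟩⟩
        rw [mem_filter, mem_powerset] at hH
        obtain ⟨hHG, hHH, hHns⟩ := hH
        have hmax' : ∀ e ∈ G, e ∉ H → ∃ D ⊆ insert e H, Circ s t D ∧ D.card < l ∧ e ∈ D := by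
          intro e heG heH
          by_contra hcon
          push Not at hcon
          have := hmax (insert e H) (by
            rw [mem_filter, mem_powerset]
            refine ⟨insert_subset heG hHG, hHH.trans (subset_insert _ _), ?_⟩
            intro D hD hDc
            by_contra hDl
            push Not at hDl
            have heD := hcon D hD hDc hDl
            have := hHns D (fun x hx => (mem_insert.1 (hD hx)).resolve_left (fun h => heD (h ▸ hx))) hDc
            omega)
          rw [card_insert_of_notMem heH] at this
          omega
        have hex : ∃ F ⊆ H, Ev s t F ∧ par Y F ≠ 0 := by
          by_contra hcon
          push Not at hcon
          have : ∀ (m : ℕ) (z : Finset E), (z \ H).card = m → z ⊆ G → Ev s t z → par Y z = 0 := by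
            intro m
            induction m using Nat.strong_induction_on with
            | _ m ihm =>
              intro z hm hz hzev
              by_cases hzH : z ⊆ H
              · exact hcon z hzH hzev
              rw [not_subset] at hzH
              obtain ⟨e, hez, heH⟩ := hzH
              obtain ⟨D, hD, hDc, hDl, heD⟩ := hmax' e (hz hez) heH
              have hDG : D ⊆ G := hD.trans (insert_subset (hz hez) hHG)
              have h1 := ihm ((z ∆ D) \ H).card (by
                rw [← hm]
                apply card_lt_card
                refine ⟨?_, fun h => ?_⟩
                · intro x hx
                  simp only [mem_sdiff, mem_symmDiff] at hx ⊢
                  refine ⟨?_, hx.2⟩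
                  rcases hx.1 with h | h
                  · exact h.1
                  · rcases mem_insert.1 (hD h.1) with h' | h'
                    · exact h' ▸ hez
                    · exact absurd h' hx.2
                · have := h (mem_sdiff.2 ⟨hez, heH⟩)
                  simp [mem_symmDiff, hez, heD] at this) (z ∆ D) rfl
                  (symmDiff_subset_union.trans (union_subset hz hDG)) (hzev.symm hDc.2.1)
              rw [par_symm, hYs D hDG hDc hDl, add_zero] at h1
              exact h1
          exact hzp (this _ z rfl hzG hze)
        obtain ⟨F, hF, hFe, hFp⟩ := hex
        have h1 := cyc_double hHH hF hFe (by
          intro hFH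
          apply hFp
          apply sum_eq_zero
          intro e he
          have := (mem_sdiff.1 (hH' (hFH he))).2
          simp [this])
        have h2 := hcyc H hHG hHns
        rw [pow_succ] at h2
        omega)
    refine ⟨Y ∪ X, ?_, ?_⟩
    · have := card_union_le Y X
      have h3 : (k - 1) * (n + 1) = (k - 1) * n + (k - 1) := by ring
      omega
    · rw [← sup_eq_union, ← sdiff_sdiff_left]; exact hXs

theorem phi_mono (k : ℕ) : phi k ≤ phi (k + 1) := by
  have := phi_step k; omega

theorem main_abs [Fintype V] [Fintype E] {l : ℕ} (hl : 1 ≤ l) (m : ℕ) :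
    ∀ G : Finset E, ¬ PackLong s t l (m + 1) G →
      ∃ X : Finset E, X.card ≤ m * phi (m + 1) + 10 * l * m ∧ AllShort s t l (G \ X) := by
  induction m with
  | zero =>
    intro G hno
    refine ⟨∅, by simp, ?_⟩
    rw [sdiff_empty]
    intro C hC hCc
    by_contra hlong
    push Not at hlong
    exact hno (PackLong.peel hC hCc hlong ⟨fun _ => ∅, by simp, by simp⟩)
  | succ m ih =>
    intro G hno
    by_cases hgap : Gap s t l G
    · obtain ⟨X, hX, hXs⟩ := iter (k := m + 2) hl (by omega) (phi (m + 2)) G hgap hno (by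
        intro H hH hns
        by_contra hcon
        push Not at hcon
        obtain ⟨P, hP1, hP2⟩ := pack (m + 2) s t H
          (le_trans (Nat.pow_le_pow_right (by norm_num) (by omega)) hcon)
        apply hno
        have : ∀ j < m + 2, ∃ D ⊆ P j, Circ s t D := by
          intro j hj
          obtain ⟨x, hx⟩ := (hP1 j hj).2.1
          obtain ⟨D, h1, h2, _⟩ := (hP1 j hj).2.2.exists_circ hx
          exact ⟨D, h1, h2⟩
        choose! D hD1 hD2 using this
        refine ⟨D, fun j hj => ?_, fun i hi j hj hij =>
          (hP2 i hi j hj hij).mono (hD1 i hi) (hD1 j hj)⟩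
        have h3 := (hD1 j hj).trans (hP1 j hj).1
        exact ⟨h3.trans hH, hD2 j hj, hns _ h3 (hD2 j hj)⟩)
      refine ⟨X, ?_, hXs⟩
      simp only [Nat.add_succ_sub_one] at hX
      exact hX.trans (Nat.le_add_right _ _)
    · unfold Gap at hgap
      push Not at hgap
      obtain ⟨C, hC, hCc, h10, hlong⟩ := hgap
      obtain ⟨X, hX, hXs⟩ := ih (G \ C) (fun h => hno (h.peel hC hCc hlong))
      refine ⟨C ∪ X, ?_, by rw [← sup_eq_union, ← sdiff_sdiff_left]; exact hXs⟩
      have h1 := card_union_le C X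
      have h2 := phi_mono (m + 1)
      have h3 : m * phi (m + 1) ≤ (m + 1) * phi (m + 1 + 1) := Nat.mul_le_mul (by omega) h2
      have h4 : 10 * l * (m + 1) = 10 * l * m + 10 * l := by ring
      omega

end main
end LC
set_option linter.unusedSectionVars false
set_option linter.unusedVariables false
namespace LC
open Finset
open scoped symmDiff

section link
variable {V : Type*} [DecidableEq V]

/-- first end -/
noncomputable def so (e : Sym2 V) : V := (Quot.out e).1
/-- second end -/
noncomputable def ta (e : Sym2 V) : V := (Quot.out e).2

theorem inc_mk (a b : V) : inc so ta s(a, b) = dl a + dl b := by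
  have h : s(so s(a, b), ta s(a, b)) = s(a, b) := by
    unfold so ta
    exact Quot.out_eq _
  unfold inc
  rcases Sym2.eq_iff.1 h with h | h
  · rw [h.1, h.2]
  · rw [h.1, h.2, add_comm]

theorem inc_walk {G : SimpleGraph V} {u v : V} (p : G.Walk u v) :
    (p.edges.map (inc so ta)).sum = dl u + dl v := by
  induction p with
  | nil => simp [two_zero']
  | @cons a b c h p ih =>
    rw [Walk.edges_cons, List.map_cons, List.sum_cons, ih, inc_mk]
    calc _ = (dl b + dl b) + (dl a + dl c) := by abel
      _ = _ := by rw [two_zero', zero_add]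

theorem bd_trail {G : SimpleGraph V} {u v : V} (p : G.Walk u v) (hp : p.IsTrail) :
    bd so ta p.edges.toFinset = dl u + dl v := by
  rw [← inc_walk p, bd, List.sum_toFinset _ hp.edges_nodup]

theorem path_no_even {G : SimpleGraph V} {u v : V} (p : G.Walk u v) (hp : p.IsPath)
    (F : Finset (Sym2 V)) (hF : ∀ e ∈ F, e ∈ p.edges) (hev : Ev so ta F) : F = ∅ := by
  induction p with
  | nil => rw [eq_empty_iff_forall_notMem]; intro e he; simpa using hF e he
  | @cons a b c h p ih =>
    rw [Walk.cons_isPath_iff] at hp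
    have hnot : s(a, b) ∉ F := by
      intro hab
      have h1 : bd so ta F a = 0 := congrFun hev a
      rw [bd_apply, sum_eq_single_of_mem _ hab] at h1
      · rw [inc_mk] at h1
        simp [dl, h.ne.symm] at h1
      · intro e he hne
        have h2 : e ∈ p.edges := by
          have := hF e he
          rw [Walk.edges_cons, List.mem_cons] at this
          exact this.resolve_left hne
        induction e using Sym2.ind with
        | _ x y =>
          rw [inc_mk]
          have hx : x ≠ a := fun h => hp.2 (h ▸ p.fst_mem_support_of_mem_edges h2)
          have hy : y ≠ a := fun h => hp.2 (h ▸ p.snd_mem_support_of_mem_edges h2)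
          simp [dl, hx, hy]
    apply ih hp.1
    intro e he
    have := hF e he
    rw [Walk.edges_cons, List.mem_cons] at this
    exact this.resolve_left (fun h => hnot (h ▸ he))

theorem circ_of_cycle {G : SimpleGraph V} {u : V} (c : G.Walk u u) (hc : c.IsCycle) :
    Circ so ta c.edges.toFinset ∧ c.edges.toFinset.card = c.length := by
  refine ⟨?_, by rw [List.toFinset_card_of_nodup hc.isTrail.edges_nodup, Walk.length_edges]⟩
  have hev : Ev so ta c.edges.toFinset := by
    unfold Ev
    rw [bd_trail c hc.isTrail, two_zero']
  cases c with
  | nil => exact absurd hc (by simp)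
  | @cons _ b _ h p =>
    have hp := (Walk.cons_isCycle_iff p h).1 hc
    refine ⟨⟨s(u, b), by simp⟩, hev, ?_⟩
    intro F hF hne hFe
    by_cases hab : s(u, b) ∈ F
    · have := path_no_even p hp.1 ((Walk.cons h p).edges.toFinset \ F) (by
        intro e he
        rw [mem_sdiff, List.mem_toFinset, Walk.edges_cons, List.mem_cons] at he
        exact he.1.resolve_left (fun h' => he.2 (h' ▸ hab))) (hev.sdiff hFe hF)
      exact hF.antisymm (sdiff_eq_empty_iff_subset.1 this)
    · exfalso
      have := path_no_even p hp.1 F (by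
        intro e he
        have := hF he
        rw [List.mem_toFinset, Walk.edges_cons, List.mem_cons] at this
        exact this.resolve_left (fun h' => hab (h' ▸ he))) hFe
      exact hne.ne_empty this

open Classical in
theorem cycle_of_circ [Fintype V] {G : SimpleGraph V} {C : Finset (Sym2 V)} (hC : ∀ e ∈ C, e ∈ G.edgeSet)
    (hCc : Circ so ta C) : ∃ (u : V) (c : G.Walk u u), c.IsCycle ∧ c.edges.toFinset = C := by
  set B : SimpleGraph V := SimpleGraph.fromEdgeSet (C : Set (Sym2 V)) with hB
  have hBa : ∀ x y, B.Adj x y ↔ s(x, y) ∈ C := by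
    intro x y
    rw [hB, SimpleGraph.fromEdgeSet_adj]
    constructor
    · intro h; exact h.1
    · intro h; exact ⟨h, (hC _ h : G.Adj x y).ne⟩
  have hBG : B ≤ G := by
    intro x y h
    exact hC _ ((hBa x y).1 h)
  have hna : ¬ B.IsAcyclic := by
    obtain ⟨e, he⟩ := hCc.1
    induction e using Sym2.ind with
    | _ x y =>
      refine not_acyclic B ?_ ((hBa x y).2 he)
      intro x
      rw [← ZMod.natCast_eq_zero_iff_even]
      have h1 : bd so ta C x = 0 := congrFun hCc.2.1 x
      rw [bd_apply] at h1
      have h2 : ∀ e ∈ C, inc so ta e x = if x ∈ e then 1 else 0 := by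
        intro e he
        induction e using Sym2.ind with
        | _ a b =>
          have hab : a ≠ b := (hC _ he : G.Adj a b).ne
          rw [inc_mk]
          simp only [dl, Pi.add_apply, Sym2.mem_iff]
          grind
      rw [sum_congr rfl h2, sum_boole] at h1
      rw [← h1]
      congr 1
      have hinj : Function.Injective (fun y => s(x, y)) := fun y z h => by
        have h' : y = z ∨ x = z ∧ y = x := by simpa using h
        rcases h' with h' | h'
        · exact h'
        · exact h'.2.trans h'.1
      rw [← card_image_of_injective _ hinj]
      congr 1
      ext e
      simp only [mem_image, mem_filter, mem_univ, true_and, hBa]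
      constructor
      · rintro ⟨y, hy, rfl⟩
        exact ⟨hy, by simp⟩
      · rintro ⟨he, hx⟩
        obtain ⟨y, rfl⟩ := hx
        exact ⟨y, he, rfl⟩
  simp only [SimpleGraph.IsAcyclic] at hna
  push Not at hna
  obtain ⟨u, c, hc⟩ := hna
  refine ⟨u, c.mapLe hBG, hc.mapLe hBG, ?_⟩
  have h3 := hCc.eq_of_subset (circ_of_cycle c hc).1 (by
    intro e he
    rw [List.mem_toFinset] at he
    have := c.edges_subset_edgeSet he
    induction e using Sym2.ind with
    | _ a b => exact (hBa a b).1 this)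
  rw [← h3]
  congr 1
  simp

end link

theorem real_bound (l m : ℕ) : ((m * phi (m + 1) + 10 * l * m : ℕ) : ℝ) ≤
    210 * ((m + 1 : ℕ) : ℝ) ^ 2 * Real.logb 2 ((m + 1 : ℕ) : ℝ) + 10 * l * (((m + 1 : ℕ) : ℝ) - 1) := by
  have key : (m : ℝ) * phi (m + 1) ≤ 210 * ((m + 1 : ℕ) : ℝ) ^ 2 * Real.logb 2 ((m + 1 : ℕ) : ℝ) := by
    rcases Nat.eq_zero_or_pos m with rfl | hm
    · simp
    have h1 : ((Nat.log 2 (m + 1) : ℕ) : ℝ) ≤ Real.logb 2 ((m + 1 : ℕ) : ℝ) := by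
      exact_mod_cast Real.natLog_le_logb (m + 1) 2
    have h2 : (1 : ℝ) ≤ Real.logb 2 ((m + 1 : ℕ) : ℝ) := by
      refine le_trans ?_ h1
      have : 1 ≤ Nat.log 2 (m + 1) := Nat.log_pos (by norm_num) (by omega)
      exact_mod_cast this
    set x := Real.logb 2 ((m + 1 : ℕ) : ℝ)
    set L := Nat.log 2 (m + 1) with hL
    have h3 : (phi (m + 1) : ℝ) = 64 * (((m : ℝ) + 1) * (L + 1)) := by
      unfold phi; rw [← hL]; push_cast; ring
    rw [h3]
    push_cast
    have hm0 : (0 : ℝ) ≤ m := Nat.cast_nonneg m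
    have h4 : ((m : ℝ) + 1) * (L + 1) ≤ ((m : ℝ) + 1) * (2 * x) :=
      mul_le_mul_of_nonneg_left (by linarith) (by linarith)
    have h5 : (m : ℝ) * (64 * (((m : ℝ) + 1) * (L + 1))) ≤ (m + 1) * (64 * (((m : ℝ) + 1) * (2 * x))) := by
      apply mul_le_mul (by linarith) (by linarith) (by positivity) (by positivity)
    have h6 : 0 ≤ ((m : ℝ) + 1) ^ 2 * x := mul_nonneg (by positivity) (by linarith)
    nlinarith
  push_cast at key ⊢
  linarith

end LC

theorem edge_erdos_posa_long_cycles
    {V : Type} [Fintype V] (G : SimpleGraph V) (ℓ k : ℕ) (hℓ : 3 ≤ ℓ) (hk : 1 ≤ k) :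
    (∃ (x : Fin k → V) (C : ∀ i, G.Walk (x i) (x i)),
        (∀ i, (C i).IsCycle ∧ ℓ ≤ (C i).length) ∧
        ∀ i j, i ≠ j → ∀ e ∈ (C i).edges, e ∉ (C j).edges) ∨
    (∃ X : Finset (Sym2 V),
        (X.card : ℝ) ≤ 210 * k ^ 2 * Real.logb 2 k + 10 * ℓ * ((k : ℝ) - 1) ∧
        ∀ (x : V) (C : (G.deleteEdges ↑X).Walk x x), C.IsCycle → C.length < ℓ) := by
  classical
  by_cases hP : LC.PackLong (LC.so (V := V)) LC.ta ℓ k G.edgeFinset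
  · left
    obtain ⟨P, hP1, hP2⟩ := hP
    have h : ∀ i : Fin k, ∃ (u : V) (c : G.Walk u u), c.IsCycle ∧ c.edges.toFinset = P i := by
      intro i
      obtain ⟨h1, h2, h3⟩ := hP1 i i.2
      exact LC.cycle_of_circ (fun e he => by simpa using h1 he) h2
    choose x C hC1 hC2 using h
    refine ⟨x, C, fun i => ⟨hC1 i, ?_⟩, ?_⟩
    · rw [← (LC.circ_of_cycle (C i) (hC1 i)).2, hC2 i]
      exact (hP1 i i.2).2.2
    · intro i j hij e hi hj
      have hd := hP2 i i.2 j j.2 (fun h => hij (Fin.ext h))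
      rw [← hC2, ← hC2] at hd
      exact Finset.disjoint_left.1 hd (List.mem_toFinset.2 hi) (List.mem_toFinset.2 hj)
  · right
    obtain ⟨m, rfl⟩ : ∃ m, k = m + 1 := ⟨k - 1, by omega⟩
    obtain ⟨X, hX, hXs⟩ := LC.main_abs (show 1 ≤ ℓ by omega) m G.edgeFinset hP
    refine ⟨X, le_trans (by exact_mod_cast hX) (LC.real_bound ℓ m), ?_⟩
    intro x C hC
    have h1 := LC.circ_of_cycle C hC
    rw [← h1.2]
    apply hXs _ _ h1.1
    intro e he
    have h2 := C.edges_subset_edgeSet (List.mem_toFinset.1 he)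
    rw [SimpleGraph.edgeSet_deleteEdges] at h2
    simpa using h2
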